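/- Composition of 1-morphisms in the 2-category T of 2-tangles is well defined: if f : A → B and g : B → C are 1-morphisms of T, represented by generic tangles chosen so that the target set of the representative of f equals the source set of the representative of g, so that the representative of f has a product structure in the z direction for z ∈ [1/4,1] and that of g has a product structure for z ∈ [0,3/4], then the equivalence class of the glued tangle (f ∩ I₁×I₂×[0,1/2]) ∪ (g ∩ I₁×I₂×[1/2,1]) is independent of all choices of representatives. -/

import Mathlib

/-! ## Geometry of tangles and 2-tangles (after Baez–Langford, HDA IV) -/

noncomputable section
open Set

namespace HDA4

abbrev Pt2 := ℝ × ℝ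
abbrev Pt3 := ℝ × ℝ × ℝ
abbrev Pt4 := ℝ × ℝ × ℝ × ℝ

/-- The unit interval `[0,1]`. -/
def II : Set ℝ := Icc 0 1
/-- The unit square `I₁ × I₂`. -/
def sq : Set Pt2 := II ×ˢ II
/-- The unit cube `I₁ × I₂ × I₃`. -/
def cube : Set Pt3 := II ×ˢ II ×ˢ II
/-- The unit 4-cube `I₁ × I₂ × I₃ × I₄`. -/
def cube4 : Set Pt4 := II ×ˢ II ×ˢ II ×ˢ II

def x3 (p : Pt3) : ℝ := p.1
def y3 (p : Pt3) : ℝ := p.2.1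
def z3 (p : Pt3) : ℝ := p.2.2
def x4 (p : Pt4) : ℝ := p.1
def y4 (p : Pt4) : ℝ := p.2.1
def z4 (p : Pt4) : ℝ := p.2.2.1
def t4 (p : Pt4) : ℝ := p.2.2.2

/-- A generic finite subset of the square: finite, contained in the interior,
with no two points sharing the same `y` coordinate. -/
structure IsGenericSubset (A : Set Pt2) : Prop where
  finite : A.Finite
  interior : A ⊆ Ioo (0:ℝ) 1 ×ˢ Ioo (0:ℝ) 1
  injY : InjOn Prod.snd A

/-- An ambient isotopy of the square: a smooth family of diffeomorphisms of `I₁ × I₂`. -/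
structure SquareIsotopy (H : Pt2 → ℝ → Pt2) : Prop where
  smooth : ContDiff ℝ (⊤ : ℕ∞) fun q : Pt2 × ℝ => H q.1 q.2
  mapsTo : ∀ s ∈ II, MapsTo (fun p => H p s) sq sq
  diffeo : ∀ s ∈ II, ∃ G : Pt2 → Pt2, ContDiff ℝ (⊤ : ℕ∞) G ∧ InvOn G (fun p => H p s) sq sq

/-- Level preserving: a fiber isotopy for the bundle `I₁ × I₂ → I₂`. -/
def LevelPreserving2 (H : Pt2 → ℝ → Pt2) : Prop :=
  ∀ s ∈ II, ∀ p q : Pt2, p.2 = q.2 → (H p s).2 = (H q s).2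

/-- Equivalence of generic finite subsets of the square. -/
def SubsetEquiv (A B : Set Pt2) : Prop :=
  ∃ H, SquareIsotopy H ∧ LevelPreserving2 H ∧
    (fun p => H p 0) '' A = A ∧ (fun p => H p 1) '' A = B

/-- A smooth regular local parametrization of `T` through `p`. -/
def LocalCurveAt (T : Set Pt3) (p : Pt3) (γ : ℝ → Pt3) (δ : ℝ) : Prop :=
  0 < δ ∧ γ 0 = p ∧ ContDiff ℝ (⊤ : ℕ∞) γ ∧ deriv γ 0 ≠ 0 ∧ ∀ t ∈ Ioo (-δ) δ, γ t ∈ T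

/-- A tangle: a compact 1-manifold with boundary smoothly embedded in
`int(I₁ × I₂) × I₃`, with boundary in `int(I₁ × I₂) × {0,1}` and a product
structure near the top and the bottom. -/
structure IsTangle (T : Set Pt3) : Prop where
  compact : IsCompact T
  subset : T ⊆ Ioo (0:ℝ) 1 ×ˢ Ioo (0:ℝ) 1 ×ˢ II
  manifold : ∀ p ∈ T, ∃ (U : Set Pt3) (γ : ℝ → Pt3) (J : Set ℝ),
    IsOpen U ∧ p ∈ U ∧ ContDiff ℝ (⊤ : ℕ∞) γ ∧ InjOn γ J ∧
    (∀ t ∈ J, deriv γ t ≠ 0) ∧ (J = Ioo (-1:ℝ) 1 ∨ J = Ico (0:ℝ) 1) ∧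
    (0:ℝ) ∈ J ∧ γ 0 = p ∧ T ∩ U = γ '' J
  boundary : ∀ p ∈ T,
    (¬ ∃ (U : Set Pt3) (γ : ℝ → Pt3), IsOpen U ∧ p ∈ U ∧ ContDiff ℝ (⊤ : ℕ∞) γ ∧
        InjOn γ (Ioo (-1:ℝ) 1) ∧ (∀ t ∈ Ioo (-1:ℝ) 1, deriv γ t ≠ 0) ∧
        γ 0 = p ∧ T ∩ U = γ '' Ioo (-1:ℝ) 1) → z3 p = 0 ∨ z3 p = 1
  product : ∃ ε > 0, ∀ x y : ℝ, ∀ z ∈ II, ∀ z' ∈ II,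
    ((z ≤ ε ∧ z' ≤ ε) ∨ (1 - ε ≤ z ∧ 1 - ε ≤ z')) →
    ((x, y, z) ∈ T ↔ (x, y, z') ∈ T)

/-- Projection of the cube onto the square `I₂ × I₃` (the plane of the diagram). -/
def pYZ (p : Pt3) : Pt2 := (p.2.1, p.2.2)

/-- A generic tangle: the projection to `I₂ × I₃` is an embedding except for
finitely many transverse double points (crossings), the critical points of the
height function `z` are nondegenerate local extrema, and all crossings and
critical points occur at distinct heights. -/
def IsGenericTangle (T : Set Pt3) : Prop :=
  IsTangle T ∧
  ∃ (Cr : Finset Pt2) (Ex : Finset Pt3),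
    (Ex : Set Pt3) ⊆ T ∧
    InjOn pYZ (T \ pYZ ⁻¹' (Cr : Set Pt2)) ∧
    (∀ c ∈ Cr, ∃ p q : Pt3, p ≠ q ∧ T ∩ pYZ ⁻¹' {c} = {p, q} ∧
      ∃ (γp γq : ℝ → Pt3) (δ : ℝ), LocalCurveAt T p γp δ ∧ LocalCurveAt T q γq δ ∧
        LinearIndependent ℝ ![pYZ (deriv γp 0), pYZ (deriv γq 0)]) ∧
    (∀ p ∈ T, (p ∈ Ex ↔ ∃ γ δ, LocalCurveAt T p γ δ ∧ deriv (fun t => z3 (γ t)) 0 = 0)) ∧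
    (∀ p ∈ Ex, ∀ γ δ, LocalCurveAt T p γ δ →
      deriv (fun t => z3 (γ t)) 0 = 0 ∧ deriv (deriv fun t => z3 (γ t)) 0 ≠ 0) ∧
    InjOn Prod.snd (Cr : Set Pt2) ∧ InjOn z3 (Ex : Set Pt3) ∧
    ∀ c ∈ Cr, ∀ p ∈ Ex, c.2 ≠ z3 p

/-- An ambient isotopy of the cube. -/
structure CubeIsotopy (H : Pt3 → ℝ → Pt3) : Prop where
  smooth : ContDiff ℝ (⊤ : ℕ∞) fun q : Pt3 × ℝ => H q.1 q.2
  mapsTo : ∀ s ∈ II, MapsTo (fun p => H p s) cube cube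
  diffeo : ∀ s ∈ II, ∃ G : Pt3 → Pt3, ContDiff ℝ (⊤ : ℕ∞) G ∧ InvOn G (fun p => H p s) cube cube

/-- An equivalence isotopy between generic tangles: level preserving for the
bundles `I₁×I₂×I₃ → I₂×I₃` and `I₁×I₂×I₃ → I₃`, with a product structure in a
neighborhood of `I₁ × I₂ × ∂I₃`. -/
structure TangleEquivIsotopy (H : Pt3 → ℝ → Pt3) : Prop where
  isotopy : CubeIsotopy H
  levelYZ : ∀ s ∈ II, ∀ p q : Pt3, pYZ p = pYZ q → pYZ (H p s) = pYZ (H q s)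
  levelZ : ∀ s ∈ II, ∀ p q : Pt3, z3 p = z3 q → z3 (H p s) = z3 (H q s)
  product : ∃ ε > 0, ∀ s ∈ II, ∀ x y : ℝ, ∀ z ∈ II,
    (z ≤ ε → H (x, y, z) s = (x3 (H (x, y, 0) s), y3 (H (x, y, 0) s), z)) ∧
    (1 - ε ≤ z → H (x, y, z) s = (x3 (H (x, y, 1) s), y3 (H (x, y, 1) s), z))

/-- Equivalence of generic tangles. -/
def TangleEquiv (T T' : Set Pt3) : Prop :=
  ∃ H, TangleEquivIsotopy H ∧ (∀ p, H p 0 = p) ∧ (fun p => H p 1) '' T = T'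

/-- The source set of a tangle. -/
def srcSet (T : Set Pt3) : Set Pt2 := {q : Pt2 | (q.1, q.2, (0:ℝ)) ∈ T}
/-- The target set of a tangle. -/
def tgtSet (T : Set Pt3) : Set Pt2 := {q : Pt2 | (q.1, q.2, (1:ℝ)) ∈ T}
/-- Gluing of tangles in the `z` direction:
`(T ∩ I₁×I₂×[0,1/2]) ∪ (T' ∩ I₁×I₂×[1/2,1])`. -/
def glueZ (T T' : Set Pt3) : Set Pt3 := {p ∈ T | z3 p ≤ 1/2} ∪ {p ∈ T' | 1/2 ≤ z3 p}
/-- A tangle has a product structure in the `z` direction on `[a,b]`. -/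
def ProductZOn (T : Set Pt3) (a b : ℝ) : Prop :=
  ∀ x y : ℝ, ∀ z ∈ Icc a b, ∀ z' ∈ Icc a b, ((x, y, z) ∈ T ↔ (x, y, z') ∈ T)
/-- The identity tangle `A × I₃` on a subset of the square. -/
def cylMor (A : Set Pt2) : Set Pt3 := {p : Pt3 | (x3 p, y3 p) ∈ A ∧ z3 p ∈ II}

/-- The slice of a subset of the 4-cube at `t = t₀`. -/
def tSlice (S : Set Pt4) (t : ℝ) : Set Pt3 := {p : Pt3 | (p.1, p.2.1, p.2.2, t) ∈ S}
/-- The source tangle of a 2-tangle. -/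
def srcTangle (S : Set Pt4) : Set Pt3 := tSlice S 0
/-- The target tangle of a 2-tangle. -/
def tgtTangle (S : Set Pt4) : Set Pt3 := tSlice S 1

/-- A 2-tangle: a compact 2-manifold with corners embedded in the 4-cube whose
boundary lies in `I₁×I₂×∂(I₃×I₄)`, meeting `I₁×I₂×I₃×∂I₄` in a pair of tangles
and `I₁×I₂×∂I₃×I₄` in finitely many straight lines, with a product structure
near the boundary. -/
structure IsTwoTangle (S : Set Pt4) : Prop where
  compact : IsCompact S
  subset : S ⊆ cube4
  manifold : ∀ p ∈ S, ∃ (U : Set Pt4) (φ : Pt2 → Pt4) (J : Set Pt2),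
    IsOpen U ∧ p ∈ U ∧ ContDiff ℝ (⊤ : ℕ∞) φ ∧ InjOn φ J ∧
    (J = Ioo (-1:ℝ) 1 ×ˢ Ioo (-1:ℝ) 1 ∨ J = Ioo (-1:ℝ) 1 ×ˢ Ico (0:ℝ) 1 ∨
      J = Ico (0:ℝ) 1 ×ˢ Ico (0:ℝ) 1) ∧
    ((0:ℝ), (0:ℝ)) ∈ J ∧ φ (0, 0) = p ∧ S ∩ U = φ '' J ∧
    ∀ q ∈ J, LinearIndependent ℝ ![fderiv ℝ φ q (1, 0), fderiv ℝ φ q (0, 1)]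
  endTangles : IsTangle (tSlice S 0) ∧ IsTangle (tSlice S 1)
  sides : ∃ L : Finset Pt3, (∀ q ∈ L, z3 q = 0 ∨ z3 q = 1) ∧
    {p ∈ S | z4 p = 0 ∨ z4 p = 1} =
      {p : Pt4 | (x4 p, y4 p, z4 p) ∈ (L : Set Pt3) ∧ t4 p ∈ II}
  productZ : ∃ ε > 0, ∀ x y t : ℝ, ∀ z ∈ II, ∀ z' ∈ II,
    ((z ≤ ε ∧ z' ≤ ε) ∨ (1 - ε ≤ z ∧ 1 - ε ≤ z')) →
    ((x, y, z, t) ∈ S ↔ (x, y, z', t) ∈ S)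
  productT : ∃ ε > 0, ∀ x y z : ℝ, ∀ t ∈ II, ∀ t' ∈ II,
    ((t ≤ ε ∧ t' ≤ ε) ∨ (1 - ε ≤ t ∧ 1 - ε ≤ t')) →
    ((x, y, z, t) ∈ S ↔ (x, y, z, t') ∈ S)

/-- A generic 2-tangle: its constant-`t` slices are generic tangles except for
finitely many values of `t` (at which exactly one of Carter–Rieger–Saito's
elementary string interactions occurs). -/
def IsGenericTwoTangle (S : Set Pt4) : Prop :=
  IsTwoTangle S ∧ ∃ F : Finset ℝ, (F : Set ℝ) ⊆ II ∧
    ∀ t ∈ II \ (F : Set ℝ), IsGenericTangle (tSlice S t)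

def p123 (p : Pt4) : Pt3 := (p.1, p.2.1, p.2.2.1)
def emb3 (p : Pt3) (t : ℝ) : Pt4 := (p.1, p.2.1, p.2.2, t)

/-- An ambient isotopy of the 4-cube. -/
structure CubeIsotopy4 (H : Pt4 → ℝ → Pt4) : Prop where
  smooth : ContDiff ℝ (⊤ : ℕ∞) fun q : Pt4 × ℝ => H q.1 q.2
  mapsTo : ∀ s ∈ II, MapsTo (fun p => H p s) cube4 cube4
  diffeo : ∀ s ∈ II, ∃ G : Pt4 → Pt4, ContDiff ℝ (⊤ : ℕ∞) G ∧ InvOn G (fun p => H p s) cube4 cube4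

/-- An equivalence isotopy between generic 2-tangles (Definition 4 of HDA IV):
restrictions at `t = 0,1` are equivalence isotopies of generic tangles,
restrictions at `z = 0,1` are level preserving, and the whole isotopy has a
product structure near `I₁ × I₂ × ∂(I₃ × I₄)`. -/
structure TwoTangleEquivIsotopy (H : Pt4 → ℝ → Pt4) : Prop where
  isotopy : CubeIsotopy4 H
  productT : ∃ ε > 0, ∀ s ∈ II, ∀ x y z : ℝ, ∀ t ∈ II,
    (t ≤ ε → H (x, y, z, t) s =
      (x4 (H (x, y, z, 0) s), y4 (H (x, y, z, 0) s), z4 (H (x, y, z, 0) s), t)) ∧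
    (1 - ε ≤ t → H (x, y, z, t) s =
      (x4 (H (x, y, z, 1) s), y4 (H (x, y, z, 1) s), z4 (H (x, y, z, 1) s), t))
  productZ : ∃ ε > 0, ∀ s ∈ II, ∀ x y t : ℝ, ∀ z ∈ II,
    (z ≤ ε → H (x, y, z, t) s =
      (x4 (H (x, y, 0, t) s), y4 (H (x, y, 0, t) s), z, t4 (H (x, y, 0, t) s))) ∧
    (1 - ε ≤ z → H (x, y, z, t) s =
      (x4 (H (x, y, 1, t) s), y4 (H (x, y, 1, t) s), z, t4 (H (x, y, 1, t) s)))
  endEquiv : ∀ t₀ : ℝ, t₀ = 0 ∨ t₀ = 1 →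
    TangleEquivIsotopy fun p s => p123 (H (emb3 p t₀) s)
  levelSides : ∀ z₀ : ℝ, z₀ = 0 ∨ z₀ = 1 → ∀ s ∈ II, ∀ p q : Pt4,
    z4 p = z₀ → z4 q = z₀ →
    ((y4 p, t4 p) = (y4 q, t4 q) → (y4 (H p s), t4 (H p s)) = (y4 (H q s), t4 (H q s))) ∧
    (t4 p = t4 q → t4 (H p s) = t4 (H q s))

/-- Equivalence of generic 2-tangles. -/
def TwoTangleEquiv (S S' : Set Pt4) : Prop :=
  ∃ H, TwoTangleEquivIsotopy H ∧ (∀ p, H p 0 = p) ∧ (fun p => H p 1) '' S = S'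

/-- Gluing of 2-tangles in the `t` direction (vertical composition). -/
def glueT (S S' : Set Pt4) : Set Pt4 := {p ∈ S | t4 p ≤ 1/2} ∪ {p ∈ S' | 1/2 ≤ t4 p}
/-- Gluing of 2-tangles in the `z` direction (horizontal composition). -/
def glueZ4 (S S' : Set Pt4) : Set Pt4 := {p ∈ S | z4 p ≤ 1/2} ∪ {p ∈ S' | 1/2 ≤ z4 p}
/-- A 2-tangle has a product structure in the `t` direction on `[a,b]`. -/
def ProductTOn (S : Set Pt4) (a b : ℝ) : Prop :=
  ∀ x y z : ℝ, ∀ t ∈ Icc a b, ∀ t' ∈ Icc a b, ((x, y, z, t) ∈ S ↔ (x, y, z, t') ∈ S)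
/-- A 2-tangle has a product structure in the `z` direction on `[a,b]`. -/
def ProductZOn4 (S : Set Pt4) (a b : ℝ) : Prop :=
  ∀ x y t : ℝ, ∀ z ∈ Icc a b, ∀ z' ∈ Icc a b, ((x, y, z, t) ∈ S ↔ (x, y, z', t) ∈ S)
/-- The identity 2-tangle `T × I₄` on a tangle `T`. -/
def cylCell (T : Set Pt3) : Set Pt4 := {p : Pt4 | (x4 p, y4 p, z4 p) ∈ T ∧ t4 p ∈ II}
/-- The identity 2-tangle `A × I₃ × I₄` on a subset `A` of the square. -/
def cylObj2 (A : Set Pt2) : Set Pt4 := {p : Pt4 | (x4 p, y4 p) ∈ A ∧ z4 p ∈ II ∧ t4 p ∈ II}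

/-- The 2-tangle traced out by an isotopy `H` applied to a tangle `U`:
`{(H(x,y,z,s),s) : (x,y,z) ∈ U}`. -/
def traceSurf (H : Pt3 → ℝ → Pt3) (U : Set Pt3) : Set Pt4 :=
  {q : Pt4 | ∃ p ∈ U, ∃ s ∈ II, q = emb3 (H p s) s}

/-- A 2-tangle which is traced out by an ambient isotopy of the cube applied to
a generic tangle; such a 2-tangle always represents a 2-isomorphism, with
inverse traced out by the reverse isotopy. -/
def IsIsotopyTrace (S : Set Pt4) : Prop :=
  ∃ H U, CubeIsotopy H ∧ (∀ p, H p 0 = p) ∧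
    (∃ ε > 0, ∀ p, (∀ s ∈ Icc (0:ℝ) ε, H p s = H p 0) ∧ ∀ s ∈ Icc (1-ε) 1, H p s = H p 1) ∧
    IsGenericTangle U ∧ S = traceSurf H U

/-- Reflection of the square in the `y` direction (duals of objects). -/
def reflY2 (A : Set Pt2) : Set Pt2 := {p : Pt2 | (p.1, 1 - p.2) ∈ A}
/-- Reflection of the cube in the `z` direction (duals of 1-morphisms). -/
def reflZ3 (T : Set Pt3) : Set Pt3 := {p : Pt3 | (p.1, p.2.1, 1 - p.2.2) ∈ T}
/-- Reflection of the 4-cube in the `t` direction (duals of 2-morphisms). -/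
def reflT4 (S : Set Pt4) : Set Pt4 := {p : Pt4 | (p.1, p.2.1, p.2.2.1, 1 - p.2.2.2) ∈ S}

end HDA4
namespace HDA4

open scoped ContDiff Topology Manifold

/-- A smooth self-bijection of a compact set with invertible derivatives along the set has a
globally defined smooth inverse. -/
theorem exists_contDiff_invOn {E : Type*} [NormedAddCommGroup E] [NormedSpace ℝ E]
    [FiniteDimensional ℝ E] {F : E → E} {K : Set E} (hK : IsCompact K)
    (hF : ContDiff ℝ ∞ F) (hbij : BijOn F K K)
    (hinj : ∀ p ∈ K, Function.Injective (fderiv ℝ F p)) :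
    ∃ G : E → E, ContDiff ℝ ∞ G ∧ InvOn G F K K := by
  classical
  have : CompleteSpace E := FiniteDimensional.complete ℝ E
  have hequiv : ∀ p ∈ K, ∃ e : E ≃L[ℝ] E, (e : E →L[ℝ] E) = fderiv ℝ F p := fun p hp =>
    ⟨(LinearEquiv.ofInjectiveEndo (fderiv ℝ F p : E →ₗ[ℝ] E) (hinj p hp)).toContinuousLinearEquiv,
      by ext; rfl⟩
  let t : E → Set E := fun y => {x | y ∈ K → x ∈ K ∧ F x = y}
  have ht : ∀ y, Convex ℝ (t y) := by
    intro y
    by_cases hy : y ∈ K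
    · refine Set.Subsingleton.convex fun u hu v hv => ?_
      exact hbij.injOn (hu hy).1 (hv hy).1 ((hu hy).2.trans (hv hy).2.symm)
    · have : t y = univ := by
        ext x
        simp [t, hy]
      rw [this]
      exact convex_univ
  have hloc : ∀ y : E, ∃ U ∈ 𝓝 y, ∃ g : E → E,
      CMDiff[U] ∞ g ∧ ∀ y' ∈ U, g y' ∈ t y' := by
    intro y
    by_cases hy : y ∈ K
    · obtain ⟨p, hp, rfl⟩ := hbij.surjOn hy
      obtain ⟨e, he⟩ := hequiv p hp
      have hder : HasFDerivAt F (e : E →L[ℝ] E) p := by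
        rw [he]
        exact (hF.differentiable (by simp)).differentiableAt.hasFDerivAt
      let Φ := hF.contDiffAt.toOpenPartialHomeomorph F hder (by simp)
      have hΦ : ∀ x, Φ x = F x := fun _ => rfl
      have hpΦ : p ∈ Φ.source :=
        ContDiffAt.mem_toOpenPartialHomeomorph_source hF.contDiffAt hder (by simp)
      let R : Set E :=
        {q | fderiv ℝ F q ∈ range ((↑) : (E ≃L[ℝ] E) → E →L[ℝ] E)}
      have hR : IsOpen R :=
        ContinuousLinearEquiv.isOpen.preimage (hF.continuous_fderiv (by simp))
      have hpR : p ∈ R := ⟨e, he⟩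
      have hN : IsOpen (Φ.source ∩ R) := Φ.open_source.inter hR
      have hclosed : IsClosed (F '' (K \ (Φ.source ∩ R))) :=
        ((hK.diff hN).image hF.continuous).isClosed
      have himg : IsOpen (Φ '' (Φ.source ∩ R)) :=
        Φ.isOpen_image_of_subset_source hN inter_subset_left
      refine ⟨Φ '' (Φ.source ∩ R) ∩ (F '' (K \ (Φ.source ∩ R)))ᶜ,
        (himg.inter hclosed.isOpen_compl).mem_nhds ⟨⟨p, ⟨hpΦ, hpR⟩, rfl⟩, ?_⟩, Φ.symm, ?_, ?_⟩
      · rintro ⟨q, hq, hqp⟩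
        exact hq.2 (hbij.injOn hq.1 hp hqp ▸ ⟨hpΦ, hpR⟩)
      · rw [contMDiffOn_iff_contDiffOn]
        rintro _ ⟨⟨q, hq, rfl⟩, -⟩
        obtain ⟨e', he'⟩ := hq.2
        refine (Φ.contDiffAt_symm (f₀' := e') (Φ.map_source hq.1) ?_ hF.contDiffAt).contDiffWithinAt
        rw [Φ.left_inv hq.1, he']
        exact (hF.differentiable (by simp)).differentiableAt.hasFDerivAt
      · rintro _ ⟨⟨q, hq, rfl⟩, hqn⟩ hqK
        rw [Φ.left_inv hq.1]
        refine ⟨?_, rfl⟩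
        obtain ⟨q', hq'K, hq'⟩ := hbij.surjOn hqK
        by_contra hqnK
        by_cases hq'N : q' ∈ Φ.source ∩ R
        · exact hqnK (Φ.injOn hq'N.1 hq.1 hq' ▸ hq'K)
        · exact hqn ⟨q', ⟨hq'K, hq'N⟩, hq'⟩
    · exact ⟨Kᶜ, hK.isClosed.isOpen_compl.mem_nhds hy, fun _ => 0, contMDiffOn_const,
        fun y' hy' h => absurd h hy'⟩
  obtain ⟨G, hG⟩ := exists_contMDiffMap_forall_mem_convex_of_local (n := ⊤) 𝓘(ℝ, E) ht hloc
  refine ⟨G, contMDiff_iff_contDiff.1 G.contMDiff, fun p hp => ?_, fun p hp => (hG p hp).2⟩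
  exact hbij.injOn (hG (F p) (hbij.mapsTo hp)).1 hp (hG (F p) (hbij.mapsTo hp)).2

/-- A smooth increasing function that is the identity up to height `1/4` and stays below `1/2`. -/
theorem exists_squeeze : ∃ κ : ℝ → ℝ, ContDiff ℝ ∞ κ ∧ (∀ z, 0 < deriv κ z) ∧
    (∀ z ≤ 1/4, κ z = z) ∧ κ 1 < 1/2 := by
  let ρ : ℝ → ℝ := fun u => 1 - 7/8 * Real.smoothTransition (16 * (u - 1/4))
  have hρ : ContDiff ℝ ∞ ρ := contDiff_const.sub (contDiff_const.mul
    (Real.smoothTransition.contDiff.comp (by fun_prop)))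
  have hint : ∀ u v, IntervalIntegrable ρ MeasureTheory.volume u v :=
    fun u v => hρ.continuous.intervalIntegrable u v
  let κ : ℝ → ℝ := fun z => ∫ u in (0:ℝ)..z, ρ u
  have hder : ∀ z, HasDerivAt κ (ρ z) z := fun z =>
    hρ.continuous.integral_hasStrictDerivAt 0 z |>.hasDerivAt
  have hderiv : deriv κ = ρ := funext fun z => (hder z).deriv
  refine ⟨κ, ?_, ?_, ?_, ?_⟩
  · rw [contDiff_infty_iff_deriv, hderiv]
    exact ⟨fun z => (hder z).differentiableAt, hρ⟩
  · intro z
    rw [hderiv]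
    have := Real.smoothTransition.le_one (16 * (z - 1/4))
    simp only [ρ]
    linarith
  · intro z hz
    have : κ z = ∫ _u in (0:ℝ)..z, (1:ℝ) := by
      refine intervalIntegral.integral_congr fun u hu => ?_
      have hu' : u ≤ 1/4 := hu.2.trans (max_le (by norm_num) hz)
      simp only [ρ]
      rw [Real.smoothTransition.zero_of_nonpos (by linarith)]
      norm_num
    simpa using this
  · have h1 : κ 1 = (∫ u in (0:ℝ)..(5/16), ρ u) + ∫ u in (5/16:ℝ)..1, ρ u :=
      (intervalIntegral.integral_add_adjacent_intervals (hint _ _) (hint _ _)).symm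
    have h2 : (∫ u in (0:ℝ)..(5/16), ρ u) ≤ ∫ _u in (0:ℝ)..(5/16), (1:ℝ) := by
      refine intervalIntegral.integral_mono_on (by norm_num) (hint _ _) (by simp) fun u _ => ?_
      have := Real.smoothTransition.nonneg (16 * (u - 1/4))
      simp only [ρ]
      linarith
    have h3 : (∫ u in (5/16:ℝ)..1, ρ u) = ∫ _u in (5/16:ℝ)..1, (1/8:ℝ) := by
      refine intervalIntegral.integral_congr fun u hu => ?_
      rw [uIcc_of_le (by norm_num)] at hu
      simp only [ρ]
      rw [Real.smoothTransition.one_of_one_le (by linarith [hu.1])]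
      norm_num
    rw [h1, h3]
    simp only [intervalIntegral.integral_const, smul_eq_mul] at h2 ⊢
    linarith

/-- The map of `ℝ³` with components `a (x, y, z)`, `b (y, z)` and `c z`. -/
def triMap (a : Pt3 → ℝ) (b : Pt2 → ℝ) (c : ℝ → ℝ) (p : Pt3) : Pt3 := (a p, b p.2, c p.2.2)

/-- The components of a smooth triangular map sending the cube to itself and strictly increasing in
each diagonal direction. -/
structure IsTri (a : Pt3 → ℝ) (b : Pt2 → ℝ) (c : ℝ → ℝ) : Prop where
  smooth_a : ContDiff ℝ ∞ a
  smooth_b : ContDiff ℝ ∞ b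
  smooth_c : ContDiff ℝ ∞ c
  mem_a : ∀ x ∈ II, ∀ y ∈ II, ∀ z ∈ II, a (x, y, z) ∈ II
  mem_b : ∀ y ∈ II, ∀ z ∈ II, b (y, z) ∈ II
  mem_c : ∀ z ∈ II, c z ∈ II
  pos_a : ∀ x ∈ II, ∀ y ∈ II, ∀ z ∈ II, 0 < deriv (fun u => a (u, y, z)) x
  pos_b : ∀ y ∈ II, ∀ z ∈ II, 0 < deriv (fun u => b (u, z)) y
  pos_c : ∀ z ∈ II, 0 < deriv c z

/-- The triangular map preserves each pair of opposite faces of the cube. -/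
structure FixesFaces (a : Pt3 → ℝ) (b : Pt2 → ℝ) (c : ℝ → ℝ) : Prop where
  face_a : ∀ y ∈ II, ∀ z ∈ II, a (0, y, z) = 0 ∧ a (1, y, z) = 1
  face_b : ∀ z ∈ II, b (0, z) = 0 ∧ b (1, z) = 1
  face_c : c 0 = 0 ∧ c 1 = 1

/-- Product structure of a triangular map along a set of heights, modelled on the height `z₀`. -/
def ProductOn (a : Pt3 → ℝ) (b : Pt2 → ℝ) (c : ℝ → ℝ) (S : Set ℝ) (z₀ : ℝ) : Prop :=
  ∀ z ∈ S, (∀ x y, a (x, y, z) = a (x, y, z₀)) ∧ (∀ y, b (y, z) = b (y, z₀)) ∧ c z = z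

/-- The slice of `f` at height `z` is carried onto the slice of `f'` at height `c z`. -/
def CarriesSlice (a : Pt3 → ℝ) (b : Pt2 → ℝ) (c : ℝ → ℝ) (f f' : Set Pt3) (z : ℝ) : Prop :=
  ∀ x' y', (x', y', c z) ∈ f' ↔ ∃ x y, (x, y, z) ∈ f ∧ a (x, y, z) = x' ∧ b (y, z) = y'

theorem zero_mem_II : (0:ℝ) ∈ II := ⟨le_rfl, zero_le_one⟩

theorem one_mem_II : (1:ℝ) ∈ II := ⟨zero_le_one, le_rfl⟩

theorem isCompact_cube : IsCompact cube := isCompact_Icc.prod (isCompact_Icc.prod isCompact_Icc)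

theorem fderiv_fst_direction {E : Type*} [NormedAddCommGroup E] [NormedSpace ℝ E]
    {f : ℝ × E → ℝ} (hf : Differentiable ℝ f) (x : ℝ) (e : E) (v : ℝ) :
    fderiv ℝ f (x, e) (v, 0) = v * deriv (fun u => f (u, e)) x := by
  have h : HasDerivAt (fun u => f (u, e)) (fderiv ℝ f (x, e) (1, 0)) x :=
    (hf (x, e)).hasFDerivAt.comp_hasDerivAt x ((hasDerivAt_id x).prodMk (hasDerivAt_const x e))
  rw [h.deriv, ← smul_eq_mul, ← map_smul]
  simp

theorem hasFDerivAt_triMap {a : Pt3 → ℝ} {b : Pt2 → ℝ} {c : ℝ → ℝ} (ha : Differentiable ℝ a)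
    (hb : Differentiable ℝ b) (hc : Differentiable ℝ c) (p : Pt3) :
    HasFDerivAt (triMap a b c) ((fderiv ℝ a p).prod
      (((fderiv ℝ b p.2).comp (ContinuousLinearMap.snd ℝ ℝ Pt2)).prod
        ((fderiv ℝ c p.2.2).comp
          ((ContinuousLinearMap.snd ℝ ℝ ℝ).comp (ContinuousLinearMap.snd ℝ ℝ Pt2))))) p := by
  refine (ha p).hasFDerivAt.prodMk (HasFDerivAt.prodMk ?_ ?_)
  · exact (hb p.2).hasFDerivAt.comp p hasFDerivAt_snd
  · exact (hc p.2.2).hasFDerivAt.comp p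
      (((ContinuousLinearMap.snd ℝ ℝ ℝ).comp (ContinuousLinearMap.snd ℝ ℝ Pt2)).hasFDerivAt)

theorem deriv_pos_of_hasDerivAt {v : ℝ → ℝ} {v' x : ℝ} (h : HasDerivAt v v' x) (hv : 0 < v') :
    0 < deriv v x :=
  h.deriv.symm ▸ hv

theorem strictMonoOn_II_of_deriv_pos {v : ℝ → ℝ} (hv : Differentiable ℝ v)
    (h : ∀ x ∈ II, 0 < deriv v x) : StrictMonoOn v II :=
  strictMonoOn_of_deriv_pos (convex_Icc 0 1) hv.continuous.continuousOn
    fun x hx => h x (interior_subset hx)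

theorem bijOn_II {v : ℝ → ℝ} (hv : Continuous v) (hm : StrictMonoOn v II)
    (h0 : v 0 = 0) (h1 : v 1 = 1) : BijOn v II II := by
  refine ⟨fun x hx => ⟨?_, ?_⟩, hm.injOn, ?_⟩
  · exact h0 ▸ hm.monotoneOn zero_mem_II hx hx.1
  · exact h1 ▸ hm.monotoneOn hx one_mem_II hx.2
  · have := intermediate_value_Icc (zero_le_one' ℝ) hv.continuousOn
    rwa [h0, h1] at this

namespace IsTri

variable {a : Pt3 → ℝ} {b : Pt2 → ℝ} {c : ℝ → ℝ}

theorem diff_slice_a (h : IsTri a b c) (y z : ℝ) : Differentiable ℝ fun u => a (u, y, z) :=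
  (h.smooth_a.differentiable (by simp)).comp (by fun_prop)

theorem diff_slice_b (h : IsTri a b c) (z : ℝ) : Differentiable ℝ fun u => b (u, z) :=
  (h.smooth_b.differentiable (by simp)).comp (by fun_prop)

theorem diff_c (h : IsTri a b c) : Differentiable ℝ c := h.smooth_c.differentiable (by simp)

theorem strictMonoOn_a (h : IsTri a b c) {y z : ℝ} (hy : y ∈ II) (hz : z ∈ II) :
    StrictMonoOn (fun u => a (u, y, z)) II :=
  strictMonoOn_II_of_deriv_pos (h.diff_slice_a y z) fun x hx => h.pos_a x hx y hy z hz

theorem strictMonoOn_b (h : IsTri a b c) {z : ℝ} (hz : z ∈ II) :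
    StrictMonoOn (fun u => b (u, z)) II :=
  strictMonoOn_II_of_deriv_pos (h.diff_slice_b z) fun x hx => h.pos_b x hx z hz

theorem strictMonoOn_c (h : IsTri a b c) : StrictMonoOn c II :=
  strictMonoOn_II_of_deriv_pos h.diff_c h.pos_c

theorem contDiff_triMap (h : IsTri a b c) : ContDiff ℝ ∞ (triMap a b c) :=
  h.smooth_a.prodMk ((h.smooth_b.comp contDiff_snd).prodMk
    (h.smooth_c.comp (contDiff_snd.comp contDiff_snd)))

theorem mapsTo (h : IsTri a b c) : MapsTo (triMap a b c) cube cube :=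
  fun ⟨x, y, z⟩ ⟨hx, hy, hz⟩ => ⟨h.mem_a x hx y hy z hz, h.mem_b y hy z hz, h.mem_c z hz⟩

theorem bijOn (h : IsTri a b c) (hf : FixesFaces a b c) : BijOn (triMap a b c) cube cube := by
  have hc := bijOn_II h.diff_c.continuous h.strictMonoOn_c hf.face_c.1 hf.face_c.2
  have hb : ∀ z ∈ II, BijOn (fun u => b (u, z)) II II := fun z hz =>
    bijOn_II (h.diff_slice_b z).continuous (h.strictMonoOn_b hz) (hf.face_b z hz).1
      (hf.face_b z hz).2
  have ha : ∀ y ∈ II, ∀ z ∈ II, BijOn (fun u => a (u, y, z)) II II := fun y hy z hz =>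
    bijOn_II (h.diff_slice_a y z).continuous (h.strictMonoOn_a hy hz) (hf.face_a y hy z hz).1
      (hf.face_a y hy z hz).2
  refine ⟨h.mapsTo, ?_, ?_⟩
  · rintro ⟨x, y, z⟩ ⟨hx, hy, hz⟩ ⟨x', y', z'⟩ ⟨hx', hy', hz'⟩ heq
    simp only [triMap, Prod.mk.injEq] at heq
    obtain rfl := hc.injOn hz hz' heq.2.2
    obtain rfl := (hb z hz).injOn hy hy' heq.2.1
    obtain rfl := (ha y hy z hz).injOn hx hx' heq.1
    rfl
  · rintro ⟨x', y', z'⟩ ⟨hx', hy', hz'⟩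
    obtain ⟨z, hz, rfl⟩ := hc.surjOn hz'
    obtain ⟨y, hy, rfl⟩ := (hb z hz).surjOn hy'
    obtain ⟨x, hx, rfl⟩ := (ha y hy z hz).surjOn hx'
    exact ⟨(x, y, z), ⟨hx, hy, hz⟩, rfl⟩

theorem injective_fderiv (h : IsTri a b c) {p : Pt3} (hp : p ∈ cube) :
    Function.Injective (fderiv ℝ (triMap a b c) p) := by
  have hda := h.smooth_a.differentiable (by simp)
  have hdb := h.smooth_b.differentiable (by simp)
  rw [(hasFDerivAt_triMap hda hdb h.diff_c p).fderiv, injective_iff_map_eq_zero]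
  obtain ⟨x, y, z⟩ := p
  obtain ⟨hx, hy, hz⟩ := hp
  rintro ⟨u, v, w⟩ huvw
  simp only [ContinuousLinearMap.prod_apply, ContinuousLinearMap.comp_apply,
    ContinuousLinearMap.coe_snd', Prod.mk_eq_zero] at huvw
  obtain ⟨h1, h2, h3⟩ := huvw
  rw [fderiv_eq_smul_deriv, smul_eq_mul] at h3
  obtain rfl := (mul_eq_zero.1 h3).resolve_right (h.pos_c z hz).ne'
  rw [fderiv_fst_direction hdb] at h2
  obtain rfl := (mul_eq_zero.1 h2).resolve_right (h.pos_b y hy z hz).ne'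
  rw [← Prod.zero_eq_mk, fderiv_fst_direction hda] at h1
  obtain rfl := (mul_eq_zero.1 h1).resolve_right (h.pos_a x hx y hy z hz).ne'
  rfl

theorem exists_inverse (h : IsTri a b c) (hf : FixesFaces a b c) :
    ∃ G : Pt3 → Pt3, ContDiff ℝ ∞ G ∧ InvOn G (triMap a b c) cube cube :=
  exists_contDiff_invOn isCompact_cube h.contDiff_triMap (h.bijOn hf)
    fun _ hp => h.injective_fderiv hp

/-- Convex combinations of two triangular maps with weights depending on the height. -/
theorem mix {a' : Pt3 → ℝ} {b' : Pt2 → ℝ} {c' l : ℝ → ℝ} (h : IsTri a b c) (h' : IsTri a' b' c')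
    (hl : ContDiff ℝ ∞ l) (hl0 : ∀ z, 0 ≤ l z) (hl1 : ∀ z, l z ≤ 1)
    (hcc' : ∀ z ∈ II, 0 ≤ deriv l z * (c' z - c z)) :
    IsTri (fun p => (1 - l p.2.2) * a p + l p.2.2 * a' p)
      (fun q => (1 - l q.2) * b q + l q.2 * b' q) (fun z => (1 - l z) * c z + l z * c' z) := by
  have hconv : ∀ z u v : ℝ, u ∈ II → v ∈ II → (1 - l z) * u + l z * v ∈ II := fun z u v hu hv =>
    convex_Icc (0:ℝ) 1 hu hv (sub_nonneg.2 (hl1 z)) (hl0 z) (by ring)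
  have hpos : ∀ z u v : ℝ, 0 < u → 0 < v → 0 < (1 - l z) * u + l z * v := fun z u v hu hv =>
    convex_Ioi (0:ℝ) hu hv (sub_nonneg.2 (hl1 z)) (hl0 z) (by ring)
  have := h.smooth_a
  have := h'.smooth_a
  have := h.smooth_b
  have := h'.smooth_b
  have := h.smooth_c
  have := h'.smooth_c
  refine ⟨by fun_prop, by fun_prop, by fun_prop, ?_, ?_, ?_, ?_, ?_, ?_⟩
  · exact fun x hx y hy z hz => hconv z _ _ (h.mem_a x hx y hy z hz) (h'.mem_a x hx y hy z hz)
  · exact fun y hy z hz => hconv z _ _ (h.mem_b y hy z hz) (h'.mem_b y hy z hz)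
  · exact fun z hz => hconv z _ _ (h.mem_c z hz) (h'.mem_c z hz)
  · intro x hx y hy z hz
    refine deriv_pos_of_hasDerivAt (((h.diff_slice_a y z x).hasDerivAt.const_mul (1 - l z)).add
      ((h'.diff_slice_a y z x).hasDerivAt.const_mul (l z))) ?_
    exact hpos z _ _ (h.pos_a x hx y hy z hz) (h'.pos_a x hx y hy z hz)
  · intro y hy z hz
    refine deriv_pos_of_hasDerivAt (((h.diff_slice_b z y).hasDerivAt.const_mul (1 - l z)).add
      ((h'.diff_slice_b z y).hasDerivAt.const_mul (l z))) ?_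
    exact hpos z _ _ (h.pos_b y hy z hz) (h'.pos_b y hy z hz)
  · intro z hz
    have hlz := (hl.differentiable (by simp) z).hasDerivAt
    refine deriv_pos_of_hasDerivAt (((hlz.const_sub 1).mul (h.diff_c z).hasDerivAt).add
      (hlz.mul (h'.diff_c z).hasDerivAt)) ?_
    nlinarith [hpos z _ _ (h.pos_c z hz) (h'.pos_c z hz), hcc' z hz]

/-- Reparametrization of the heights in the source and in the target. -/
theorem reparam {σ κ : ℝ → ℝ} (h : IsTri a b c) (hσ : ContDiff ℝ ∞ σ) (hκ : ContDiff ℝ ∞ κ)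
    (hσm : MapsTo σ II II) (hκm : MapsTo κ II II) (hσp : ∀ z ∈ II, 0 < deriv σ z)
    (hκp : ∀ z ∈ II, 0 < deriv κ z) :
    IsTri (fun p => a (p.1, p.2.1, σ p.2.2)) (fun q => b (q.1, σ q.2)) (fun z => κ (c (σ z))) := by
  have := h.smooth_a
  have := h.smooth_b
  have := h.smooth_c
  refine ⟨by fun_prop, by fun_prop, by fun_prop, ?_, ?_, ?_, ?_, ?_, ?_⟩
  · exact fun x hx y hy z hz => h.mem_a x hx y hy _ (hσm hz)
  · exact fun y hy z hz => h.mem_b y hy _ (hσm hz)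
  · exact fun z hz => hκm (h.mem_c _ (hσm hz))
  · exact fun x hx y hy z hz => h.pos_a x hx y hy _ (hσm hz)
  · exact fun y hy z hz => h.pos_b y hy _ (hσm hz)
  · intro z hz
    have h1 := (hσ.differentiable (by simp) z).hasDerivAt
    have h2 := (h.diff_c (σ z)).hasDerivAt
    have h3 := (hκ.differentiable (by simp) (c (σ z))).hasDerivAt
    refine deriv_pos_of_hasDerivAt (h3.comp z (h2.comp z h1)) ?_
    exact mul_pos (hκp _ (h.mem_c _ (hσm hz))) (mul_pos (h.pos_c _ (hσm hz)) (hσp z hz))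

end IsTri

theorem isTri_id : IsTri (fun p => p.1) (fun q => q.1) (fun z => z) := by
  refine ⟨by fun_prop, by fun_prop, by fun_prop, fun _ hx _ _ _ _ => hx, fun _ hy _ _ => hy,
    fun _ hz => hz, ?_, ?_, ?_⟩ <;> simp

/-- A triangular map carrying `T` to `T'` slice by slice gives an equivalence of tangles, through
the straight line isotopy from the identity. -/
theorem tangleEquiv_of_isTri {a : Pt3 → ℝ} {b : Pt2 → ℝ} {c : ℝ → ℝ} {T T' : Set Pt3}
    (h : IsTri a b c) (hf : FixesFaces a b c) {ε : ℝ} (hε : 0 < ε)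
    (hbot : ProductOn a b c (II ∩ Iic ε) 0) (htop : ProductOn a b c (II ∩ Ici (1 - ε)) 1)
    (hT : ∀ p ∈ T, p.2.2 ∈ II) (hT' : ∀ p ∈ T', p.2.2 ∈ II)
    (hcar : ∀ z ∈ II, CarriesSlice a b c T T' z) : TangleEquiv T T' := by
  have hmix : ∀ s ∈ II, IsTri (fun p => (1 - s) * p.1 + s * a p)
      (fun q => (1 - s) * q.1 + s * b q) (fun z => (1 - s) * z + s * c z) := fun s hs =>
    isTri_id.mix h (l := fun _ => s) contDiff_const (fun _ => hs.1) (fun _ => hs.2) (by simp)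
  have hfix : ∀ s, FixesFaces (fun p => (1 - s) * p.1 + s * a p)
      (fun q => (1 - s) * q.1 + s * b q) (fun z => (1 - s) * z + s * c z) := by
    intro s
    refine ⟨fun y hy z hz => ?_, fun z hz => ?_, ?_⟩
    · simp [hf.face_a y hy z hz]
    · simp [hf.face_b z hz]
    · simp [hf.face_c]
  refine ⟨fun p s => triMap (fun p => (1 - s) * p.1 + s * a p) (fun q => (1 - s) * q.1 + s * b q)
    (fun z => (1 - s) * z + s * c z) p, ⟨⟨?_, ?_, ?_⟩, ?_, ?_, ?_⟩, ?_, ?_⟩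
  · have := h.smooth_a
    have := h.smooth_b
    have := h.smooth_c
    simp only [triMap]
    fun_prop
  · exact fun s hs => (hmix s hs).mapsTo
  · exact fun s hs => (hmix s hs).exists_inverse (hfix s)
  · rintro s - ⟨x, y, z⟩ ⟨x', y', z'⟩ hpq
    simp only [pYZ, Prod.mk.injEq] at hpq
    obtain ⟨rfl, rfl⟩ := hpq
    rfl
  · rintro s - ⟨x, y, z⟩ ⟨x', y', z'⟩ hpq
    simp only [z3] at hpq
    obtain rfl := hpq
    rfl
  · refine ⟨ε, hε, fun s _ x y z hz => ⟨fun hzε => ?_, fun hzε => ?_⟩⟩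
    · obtain ⟨h1, h2, h3⟩ := hbot z ⟨hz, hzε⟩
      simp only [triMap, x3, y3, h1, h2, h3, Prod.mk.injEq, true_and]
      ring
    · obtain ⟨h1, h2, h3⟩ := htop z ⟨hz, hzε⟩
      simp only [triMap, x3, y3, h1, h2, h3, Prod.mk.injEq, true_and]
      ring
  · simp [triMap]
  · simp only [sub_self, zero_mul, one_mul, zero_add]
    ext ⟨x', y', z'⟩
    constructor
    · rintro ⟨⟨x, y, z⟩, hp, hpp⟩
      simp only [triMap, Prod.mk.injEq] at hpp
      obtain ⟨h1, h2, rfl⟩ := hpp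
      exact (hcar z (hT _ hp) x' y').2 ⟨x, y, hp, h1, h2⟩
    · intro hp
      obtain ⟨z, hz, rfl⟩ := (bijOn_II h.diff_c.continuous h.strictMonoOn_c hf.face_c.1
        hf.face_c.2).surjOn (hT' _ hp)
      obtain ⟨x, y, hxy, rfl, rfl⟩ := (hcar z hz x' y').1 hp
      exact ⟨(x, y, z), hxy, rfl⟩

theorem deriv_pos_of_deformation {ψ : ℝ × ℝ → ℝ} (hψ : ContDiff ℝ ∞ ψ) (h0 : ∀ u, ψ (u, 0) = u)
    {x : ℝ} (hne : ∀ s ∈ II, deriv (fun u => ψ (u, s)) x ≠ 0) :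
    0 < deriv (fun u => ψ (u, 1)) x := by
  have hcont : Continuous fun s => deriv (fun u => ψ (u, s)) x := by
    have h1 : (fun s => deriv (fun u => ψ (u, s)) x) = fun s => fderiv ℝ ψ (x, s) (1, 0) := by
      ext s
      rw [fderiv_fst_direction (hψ.differentiable (by simp)), one_mul]
    rw [h1]
    have := hψ.continuous_fderiv (by simp)
    fun_prop
  by_contra! hle
  have himg := intermediate_value_Icc' (zero_le_one' ℝ) hcont.continuousOn
  obtain ⟨s, hs, hs0⟩ := himg ⟨hle, by simp [h0]⟩
  exact hne s hs hs0

/-- The diagonal derivatives of a triangular map with a smooth left inverse on the cube do not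
vanish. -/
theorem diagonal_deriv_ne_zero {a : Pt3 → ℝ} {b : Pt2 → ℝ} {c : ℝ → ℝ} (ha : ContDiff ℝ ∞ a)
    (hb : ContDiff ℝ ∞ b) (hc : ContDiff ℝ ∞ c) {G : Pt3 → Pt3} (hG : ContDiff ℝ ∞ G)
    (hinv : LeftInvOn G (triMap a b c) cube) {x y z : ℝ} (hx : x ∈ II) (hy : y ∈ II)
    (hz : z ∈ II) :
    deriv (fun u => a (u, y, z)) x ≠ 0 ∧ deriv (fun u => b (u, z)) y ≠ 0 ∧ deriv c z ≠ 0 := by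
  have hda := ha.differentiable (by simp)
  have hdb := hb.differentiable (by simp)
  have hdc := hc.differentiable (by simp)
  have hp : (x, y, z) ∈ cube := ⟨hx, hy, hz⟩
  have hF := hasFDerivAt_triMap hda hdb hdc (x, y, z)
  set L := (fderiv ℝ a (x, y, z)).prod
      (((fderiv ℝ b (x, y, z).2).comp (ContinuousLinearMap.snd ℝ ℝ Pt2)).prod
        ((fderiv ℝ c (x, y, z).2.2).comp
          ((ContinuousLinearMap.snd ℝ ℝ ℝ).comp (ContinuousLinearMap.snd ℝ ℝ Pt2)))) with hL
  have hud : UniqueDiffWithinAt ℝ cube (x, y, z) :=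
    ((uniqueDiffOn_Icc zero_lt_one).prod ((uniqueDiffOn_Icc zero_lt_one).prod
      (uniqueDiffOn_Icc zero_lt_one))) _ hp
  have hcomp : (fderiv ℝ G (triMap a b c (x, y, z))).comp L = ContinuousLinearMap.id ℝ Pt3 := by
    refine hud.eq (f := id) ?_ (hasFDerivWithinAt_id _ _)
    refine (((hG.differentiable (by simp)) _).hasFDerivAt.comp (x, y, z)
      hF).hasFDerivWithinAt.congr (fun q hq => ?_) ?_
    · exact (hinv hq).symm
    · exact (hinv hp).symm
  have hinj : Function.Injective (L : Pt3 →ₗ[ℝ] Pt3) := fun u v huv => by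
    have h1 := congrArg (fderiv ℝ G (triMap a b c (x, y, z))) huv
    have h2 := fun w => DFunLike.congr_fun hcomp w
    simp only [ContinuousLinearMap.comp_apply, ContinuousLinearMap.id_apply] at h2
    exact (h2 u).symm.trans (h1.trans (h2 v))
  have hsurj := LinearMap.injective_iff_surjective.1 hinj
  have hcoord : ∀ u v w : ℝ, L (u, v, w) =
      (fderiv ℝ a (x, y, z) (u, v, w), fderiv ℝ b (y, z) (v, w), w * deriv c z) := fun u v w => by
    simp [hL]
  have hc0 : deriv c z ≠ 0 := by
    obtain ⟨⟨u, v, w⟩, huvw⟩ := hsurj (0, 0, 1)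
    rw [ContinuousLinearMap.coe_coe, hcoord, Prod.mk.injEq, Prod.mk.injEq] at huvw
    exact right_ne_zero_of_mul (huvw.2.2.trans_ne one_ne_zero)
  have hb0 : deriv (fun u => b (u, z)) y ≠ 0 := by
    obtain ⟨⟨u, v, w⟩, huvw⟩ := hsurj (0, 1, 0)
    rw [ContinuousLinearMap.coe_coe, hcoord, Prod.mk.injEq, Prod.mk.injEq] at huvw
    obtain ⟨-, h2, h3⟩ := huvw
    obtain rfl := (mul_eq_zero.1 h3).resolve_right hc0
    rw [fderiv_fst_direction hdb] at h2
    exact right_ne_zero_of_mul (h2.trans_ne one_ne_zero)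
  refine ⟨?_, hb0, hc0⟩
  obtain ⟨⟨u, v, w⟩, huvw⟩ := hsurj (1, 0, 0)
  rw [ContinuousLinearMap.coe_coe, hcoord, Prod.mk.injEq, Prod.mk.injEq] at huvw
  obtain ⟨h1, h2, h3⟩ := huvw
  obtain rfl := (mul_eq_zero.1 h3).resolve_right hc0
  rw [fderiv_fst_direction hdb] at h2
  obtain rfl := (mul_eq_zero.1 h2).resolve_right hb0
  rw [← Prod.zero_eq_mk, fderiv_fst_direction hda] at h1
  exact right_ne_zero_of_mul (h1.trans_ne one_ne_zero)

/-- The final stage of an equivalence of tangles is a triangular map. -/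
theorem exists_isTri_of_tangleEquiv {T T' : Set Pt3} (hT : ∀ p ∈ T, p.2.2 ∈ II)
    (h : TangleEquiv T T') : ∃ a b c, IsTri a b c ∧
      (∃ ε > 0, ProductOn a b c (II ∩ Iic ε) 0 ∧ ProductOn a b c (II ∩ Ici (1 - ε)) 1) ∧
      ∀ z ∈ II, CarriesSlice a b c T T' z := by
  obtain ⟨H, ⟨⟨hsm, hmaps, hdiff⟩, hYZ, hZ, ε, hε, hprod⟩, h0, rfl⟩ := h
  let a : ℝ → Pt3 → ℝ := fun s p => (H p s).1
  let b : ℝ → Pt2 → ℝ := fun s q => (H (0, q) s).2.1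
  let c : ℝ → ℝ → ℝ := fun s z => (H (0, 0, z) s).2.2
  have htri : ∀ s ∈ II, ∀ p, H p s = triMap (a s) (b s) (c s) p := by
    rintro s hs ⟨x, y, z⟩
    have h1 := hYZ s hs (x, y, z) (0, y, z) rfl
    have h2 := hZ s hs (x, y, z) (0, 0, z) rfl
    simp only [pYZ, Prod.mk.injEq] at h1
    exact Prod.ext rfl (Prod.ext h1.1 h2)
  have ha : ∀ s, ContDiff ℝ ∞ (a s) := fun s => by
    have : ContDiff ℝ ∞ fun p : Pt3 => H p s :=
      hsm.comp (contDiff_id.prodMk contDiff_const)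
    exact contDiff_fst.comp this
  have hb : ∀ s, ContDiff ℝ ∞ (b s) := fun s => by
    have : ContDiff ℝ ∞ fun q : Pt2 => H (0, q) s :=
      hsm.comp ((contDiff_const.prodMk contDiff_id).prodMk contDiff_const)
    exact contDiff_fst.comp (contDiff_snd.comp this)
  have hc : ∀ s, ContDiff ℝ ∞ (c s) := fun s => by
    have : ContDiff ℝ ∞ fun z : ℝ => H (0, 0, z) s :=
      hsm.comp ((contDiff_const.prodMk (contDiff_const.prodMk contDiff_id)).prodMk contDiff_const)
    exact contDiff_snd.comp (contDiff_snd.comp this)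
  have hne : ∀ s ∈ II, ∀ x ∈ II, ∀ y ∈ II, ∀ z ∈ II, deriv (fun u => a s (u, y, z)) x ≠ 0 ∧
      deriv (fun u => b s (u, z)) y ≠ 0 ∧ deriv (c s) z ≠ 0 := by
    intro s hs x hx y hy z hz
    obtain ⟨G, hG, hinv⟩ := hdiff s hs
    refine diagonal_deriv_ne_zero (ha s) (hb s) (hc s) hG (fun p hp => ?_) hx hy hz
    rw [← htri s hs]
    exact hinv.1 hp
  have h1 := one_mem_II
  have hzero := zero_mem_II
  have hT1 : IsTri (a 1) (b 1) (c 1) := by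
    refine ⟨ha 1, hb 1, hc 1, ?_, ?_, ?_, ?_, ?_, ?_⟩
    · exact fun x hx y hy z hz => (hmaps 1 h1 (x := (x, y, z)) ⟨hx, hy, hz⟩).1
    · exact fun y hy z hz => (hmaps 1 h1 (x := (0, y, z)) ⟨hzero, hy, hz⟩).2.1
    · exact fun z hz => (hmaps 1 h1 (x := (0, 0, z)) ⟨hzero, hzero, hz⟩).2.2
    · intro x hx y hy z hz
      refine deriv_pos_of_deformation (ψ := fun q => (H (q.1, y, z) q.2).1) ?_ (by simp [h0])
        fun s hs => (hne s hs x hx y hy z hz).1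
      exact contDiff_fst.comp (hsm.comp (by fun_prop :
        ContDiff ℝ ∞ fun q : ℝ × ℝ => (((q.1, y, z) : Pt3), q.2)))
    · intro y hy z hz
      refine deriv_pos_of_deformation (ψ := fun q => (H (0, q.1, z) q.2).2.1) ?_ (by simp [h0])
        fun s hs => (hne s hs 0 hzero y hy z hz).2.1
      exact contDiff_fst.comp (contDiff_snd.comp (hsm.comp (by fun_prop :
        ContDiff ℝ ∞ fun q : ℝ × ℝ => (((0, q.1, z) : Pt3), q.2))))
    · intro z hz
      refine deriv_pos_of_deformation (ψ := fun q => (H (0, 0, q.1) q.2).2.2) ?_ (by simp [h0])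
        fun s hs => (hne s hs 0 hzero 0 hzero z hz).2.2
      exact contDiff_snd.comp (contDiff_snd.comp (hsm.comp (by fun_prop :
        ContDiff ℝ ∞ fun q : ℝ × ℝ => (((0, 0, q.1) : Pt3), q.2))))
  refine ⟨a 1, b 1, c 1, hT1, ⟨ε, hε, ?_, ?_⟩, ?_⟩
  · rintro z ⟨hz, hzε⟩
    have := fun x y => (hprod 1 h1 x y z hz).1 hzε
    refine ⟨fun x y => ?_, fun y => ?_, ?_⟩
    · simp only [a, this, x3]
    · simp only [b, this, y3]
    · simp only [c, this]
  · rintro z ⟨hz, hzε⟩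
    have := fun x y => (hprod 1 h1 x y z hz).2 hzε
    refine ⟨fun x y => ?_, fun y => ?_, ?_⟩
    · simp only [a, this, x3]
    · simp only [b, this, y3]
    · simp only [c, this]
  · intro z hz x' y'
    simp only [mem_image, htri 1 h1]
    constructor
    · rintro ⟨⟨x, y, z'⟩, hp, hpp⟩
      simp only [triMap, Prod.mk.injEq] at hpp
      obtain rfl := hT1.strictMonoOn_c.injOn (hT _ hp) hz hpp.2.2
      exact ⟨x, y, hp, hpp.1, hpp.2.1⟩
    · rintro ⟨x, y, hp, rfl, rfl⟩
      exact ⟨_, hp, rfl⟩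

/-- The value `v` modified for `x` near `0` and near `1`, so that it is `m * x` at the left end and
`1 - m * (1 - x)` at the right end. -/
def cap (m δ x v : ℝ) : ℝ :=
  v + (1 - Real.smoothTransition (x / δ)) * (m * x - v) +
    Real.smoothTransition ((x - (1 - δ)) / δ) * (1 - m * (1 - x) - v)

theorem contDiff_cap (m δ : ℝ) : ContDiff ℝ ∞ fun q : ℝ × ℝ => cap m δ q.1 q.2 := by
  have h : ContDiff ℝ ∞ Real.smoothTransition := Real.smoothTransition.contDiff
  simp only [cap, div_eq_mul_inv]
  fun_prop

theorem cap_of_mem {m δ x v : ℝ} (hδ : 0 < δ) (hx : x ∈ Icc δ (1 - δ)) : cap m δ x v = v := by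
  rw [cap, Real.smoothTransition.one_of_one_le ((one_le_div hδ).2 hx.1),
    Real.smoothTransition.zero_of_nonpos (div_nonpos_of_nonpos_of_nonneg (by linarith [hx.2]) hδ.le)]
  ring

theorem cap_zero {m δ v : ℝ} (hδ : 0 < δ) (hδ' : δ < 1/2) : cap m δ 0 v = 0 := by
  rw [cap, Real.smoothTransition.zero_of_nonpos (zero_div δ).le,
    Real.smoothTransition.zero_of_nonpos (div_nonpos_of_nonpos_of_nonneg (by linarith) hδ.le)]
  ring

theorem cap_one {m δ v : ℝ} (hδ : 0 < δ) (hδ' : δ < 1/2) : cap m δ 1 v = 1 := by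
  rw [cap, Real.smoothTransition.one_of_one_le ((one_le_div hδ).2 (by linarith)),
    Real.smoothTransition.one_of_one_le ((one_le_div hδ).2 (by linarith))]
  ring

theorem deriv_cap_pos {m δ : ℝ} (hm : 0 < m) (hδ : 0 < δ) (hδ' : δ < 1/2) {v : ℝ → ℝ}
    (hv : Differentiable ℝ v) (hmem : MapsTo v II II) (hmv : ∀ x ∈ II, m ≤ deriv v x) {x : ℝ}
    (hx : x ∈ II) : 0 < deriv (fun u => cap m δ u (v u)) x := by
  have hmvt : ∀ s ∈ II, ∀ t ∈ II, s ≤ t → m * (t - s) ≤ v t - v s :=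
    (convex_Icc (0:ℝ) 1).mul_sub_le_image_sub_of_le_deriv hv.continuous.continuousOn
      hv.differentiableOn fun u hu => hmv u (interior_subset hu)
  have hlow : m * x ≤ v x := by
    have := hmvt 0 zero_mem_II x hx hx.1
    linarith [(hmem zero_mem_II).1]
  have hhigh : v x ≤ 1 - m * (1 - x) := by
    have := hmvt x hx 1 one_mem_II hx.2
    linarith [(hmem one_mem_II).2]
  let χ₀ : ℝ → ℝ := fun u => Real.smoothTransition (u / δ)
  let χ₁ : ℝ → ℝ := fun u => Real.smoothTransition ((u - (1 - δ)) / δ)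
  have hτ : ContDiff ℝ ∞ Real.smoothTransition := Real.smoothTransition.contDiff
  have hχ₀ : Differentiable ℝ χ₀ :=
    (hτ.differentiable (by simp)).comp (by fun_prop)
  have hχ₁ : Differentiable ℝ χ₁ :=
    (hτ.differentiable (by simp)).comp (by fun_prop)
  have hmono₀ : Monotone χ₀ := fun s t hst =>
    Real.smoothTransition.monotone (by gcongr)
  have hmono₁ : Monotone χ₁ := fun s t hst =>
    Real.smoothTransition.monotone (by gcongr)
  have hsum : 0 ≤ χ₀ x - χ₁ x := by
    rcases le_total x (1 - δ) with hx' | hx'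
    · have : χ₁ x = 0 := Real.smoothTransition.zero_of_nonpos
        (div_nonpos_of_nonpos_of_nonneg (by linarith) hδ.le)
      rw [this, sub_zero]
      exact Real.smoothTransition.nonneg _
    · have : χ₀ x = 1 := Real.smoothTransition.one_of_one_le ((one_le_div hδ).2 (by linarith))
      rw [this, sub_nonneg]
      exact Real.smoothTransition.le_one _
  have hid := hasDerivAt_id x
  refine deriv_pos_of_hasDerivAt (((hv x).hasDerivAt.add
    (((hχ₀ x).hasDerivAt.const_sub 1).mul ((hid.const_mul m).sub (hv x).hasDerivAt))).add
    ((hχ₁ x).hasDerivAt.mul ((((hid.const_sub 1).const_mul m).const_sub 1).sub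
      (hv x).hasDerivAt))) ?_
  simp only [Pi.sub_apply, id]
  nlinarith [mul_nonneg hsum (sub_nonneg.2 (hmv x hx)),
    mul_nonneg (hmono₀.deriv_nonneg (x := x)) (sub_nonneg.2 hlow),
    mul_nonneg (hmono₁.deriv_nonneg (x := x)) (sub_nonneg.2 hhigh)]

theorem exists_pos_le_deriv {E : Type*} [NormedAddCommGroup E] [NormedSpace ℝ E]
    {f : ℝ × E → ℝ} (hf : ContDiff ℝ ∞ f) {K : Set (ℝ × E)} (hK : IsCompact K)
    (hpos : ∀ p ∈ K, 0 < deriv (fun u => f (u, p.2)) p.1) :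
    ∃ m > 0, ∀ p ∈ K, m ≤ deriv (fun u => f (u, p.2)) p.1 := by
  have hcont : Continuous fun p : ℝ × E => deriv (fun u => f (u, p.2)) p.1 := by
    have h1 : (fun p : ℝ × E => deriv (fun u => f (u, p.2)) p.1) =
        fun p => fderiv ℝ f p (1, 0) := by
      ext ⟨x, e⟩
      rw [fderiv_fst_direction (hf.differentiable (by simp)), one_mul]
    rw [h1]
    have := hf.continuous_fderiv (by simp)
    fun_prop
  exact hK.exists_forall_le' hcont.continuousOn hpos

/-- A triangular map can be modified near the vertical faces of the cube so as to preserve them. -/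
theorem IsTri.exists_fixesFaces {a : Pt3 → ℝ} {b : Pt2 → ℝ} {c : ℝ → ℝ} (h : IsTri a b c)
    (hc0 : c 0 = 0) (hc1 : c 1 = 1) {δ : ℝ} (hδ : 0 < δ) (hδ' : δ < 1/2) :
    ∃ φ : ℝ → ℝ → ℝ, (∀ x ∈ Icc δ (1 - δ), ∀ v, φ x v = v) ∧
      IsTri (fun p => φ p.1 (a p)) (fun q => φ q.1 (b q)) c ∧
      FixesFaces (fun p => φ p.1 (a p)) (fun q => φ q.1 (b q)) c := by
  obtain ⟨m₁, hm₁, ha⟩ := exists_pos_le_deriv h.smooth_a isCompact_cube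
    fun p hp => h.pos_a _ hp.1 _ hp.2.1 _ hp.2.2
  obtain ⟨m₂, hm₂, hb⟩ := exists_pos_le_deriv h.smooth_b
    (isCompact_Icc.prod isCompact_Icc : IsCompact sq) fun q hq => h.pos_b _ hq.1 _ hq.2
  have hm : 0 < min m₁ m₂ := lt_min hm₁ hm₂
  have hsm := contDiff_cap (min m₁ m₂) δ
  have hmem : ∀ v : ℝ → ℝ, Differentiable ℝ v →
      (∀ x ∈ II, 0 < deriv (fun u => cap (min m₁ m₂) δ u (v u)) x) →
      MapsTo (fun u => cap (min m₁ m₂) δ u (v u)) II II := fun v hv hp => by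
    have hd : Differentiable ℝ fun u => cap (min m₁ m₂) δ u (v u) :=
      (hsm.differentiable (by simp)).comp (by fun_prop : Differentiable ℝ fun u => (u, v u))
    exact (bijOn_II hd.continuous (strictMonoOn_II_of_deriv_pos hd hp) (cap_zero hδ hδ')
      (cap_one hδ hδ')).mapsTo
  have hpa : ∀ x ∈ II, ∀ y ∈ II, ∀ z ∈ II,
      0 < deriv (fun u => cap (min m₁ m₂) δ u (a (u, y, z))) x := fun x hx y hy z hz =>
    deriv_cap_pos hm hδ hδ' (h.diff_slice_a y z) (fun u hu => h.mem_a u hu y hy z hz)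
      (fun u hu => (min_le_left _ _).trans (ha (u, y, z) ⟨hu, hy, hz⟩)) hx
  have hpb : ∀ y ∈ II, ∀ z ∈ II,
      0 < deriv (fun u => cap (min m₁ m₂) δ u (b (u, z))) y := fun y hy z hz =>
    deriv_cap_pos hm hδ hδ' (h.diff_slice_b z) (fun u hu => h.mem_b u hu z hz)
      (fun u hu => (min_le_right _ _).trans (hb (u, z) ⟨hu, hz⟩)) hy
  refine ⟨cap (min m₁ m₂) δ, fun x hx v => cap_of_mem hδ hx, ⟨?_, ?_, h.smooth_c, ?_, ?_, h.mem_c,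
    hpa, hpb, h.pos_c⟩, ⟨fun _ _ _ _ => ⟨cap_zero hδ hδ', cap_one hδ hδ'⟩,
    fun _ _ => ⟨cap_zero hδ hδ', cap_one hδ hδ'⟩, hc0, hc1⟩⟩
  · exact hsm.comp (contDiff_fst.prodMk h.smooth_a)
  · exact hsm.comp (contDiff_fst.prodMk h.smooth_b)
  · exact fun x hx y hy z hz =>
      hmem _ (h.diff_slice_a y z) (fun u hu => hpa u hu y hy z hz) hx
  · exact fun y hy z hz => hmem _ (h.diff_slice_b z) (fun u hu => hpb u hu z hz) hy

/-- The slice of a subset of the cube at height `z`. -/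
def slice (T : Set Pt3) (z : ℝ) : Set Pt2 := {q | (q.1, q.2, z) ∈ T}

/-- A Lipschitz curve contains only finitely many vertical segments of a given height. -/
theorem finite_of_vertical_subset_curve {γ : ℝ → Pt3} (hγ : ContDiff ℝ ∞ γ) {J : Set ℝ}
    (hJ : MeasurableSet J) (hJ1 : J ⊆ Icc (-1) 1) {A : Set Pt2} {r s : ℝ} (hrs : r < s)
    (hA : ∀ q ∈ A, ∀ z ∈ Ioo r s, (q.1, q.2, z) ∈ γ '' J) : A.Finite := by
  have hz : ContDiff ℝ 1 fun t => (γ t).2.2 :=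
    contDiff_snd.comp (contDiff_snd.comp (hγ.of_le (by exact_mod_cast le_top)))
  obtain ⟨K, hK⟩ := hz.locallyLipschitz.locallyLipschitzOn.exists_lipschitzOnWith_of_compact
    (isCompact_Icc (a := (-1:ℝ)) (b := 1))
  let P : A → Set ℝ := fun q => J ∩ {t | ((γ t).1, (γ t).2.1) = q.1}
  have hγc := hγ.continuous
  have hP : ∀ q, MeasurableSet (P q) := fun q =>
    hJ.inter (isClosed_eq (by fun_prop) continuous_const).measurableSet
  have hdisj : Pairwise (Function.onFun Disjoint P) := fun q q' hqq' =>
    disjoint_left.2 fun t ht ht' => hqq' (Subtype.ext (ht.2.symm.trans ht'.2))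
  have hfin : MeasureTheory.volume (⋃ q, P q) ≠ ⊤ := by
    refine ne_top_of_le_ne_top ?_ (MeasureTheory.measure_mono
      (iUnion_subset fun q => inter_subset_left.trans hJ1))
    simp
  have hlow : ∀ q, ENNReal.ofReal (s - r) / (K + 1) ≤ MeasureTheory.volume (P q) := by
    intro q
    have h1 := (hK.mono (inter_subset_left.trans hJ1 : P q ⊆ _)).hausdorffMeasure_image_le
      zero_le_one
    rw [MeasureTheory.hausdorffMeasure_real, ENNReal.rpow_one] at h1
    have h2 : Ioo r s ⊆ (fun t => (γ t).2.2) '' P q := by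
      intro z hz
      obtain ⟨t, ht, hteq⟩ := hA q.1 q.2 z hz
      exact ⟨t, ⟨ht, by simp [hteq]⟩, by simp [hteq]⟩
    have h3 := (MeasureTheory.measure_mono h2).trans h1
    rw [Real.volume_Ioo] at h3
    refine ENNReal.div_le_of_le_mul' (h3.trans ?_)
    gcongr
    exact le_self_add
  have hpos : 0 < ENNReal.ofReal (s - r) / (K + 1) :=
    ENNReal.div_pos (by simpa using hrs) (by finiteness)
  have := MeasureTheory.Measure.finite_const_le_meas_of_disjoint_iUnion _ hpos hP hdisj hfin
  simp only [hlow, ofPred_true] at this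
  exact finite_coe_iff.1 (finite_univ_iff.1 this)

/-- Where a tangle is a product, its slices are finite. -/
theorem finite_slice {T : Set Pt3} (hT : IsTangle T) {r s w : ℝ} (hw : w ∈ Ioo r s)
    (hprod : ProductZOn T r s) : (slice T w).Finite := by
  have hcomp : IsCompact (slice T w) := by
    refine Topology.IsClosedEmbedding.isCompact_preimage (f := fun q : Pt2 => (q.1, q.2, w)) ?_
      hT.compact
    refine Topology.IsClosedEmbedding.of_continuous_injective_isClosedMap (by fun_prop) ?_ ?_
    · rintro ⟨x, y⟩ ⟨x', y'⟩ h
      simpa using h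
    · intro S hS
      have : (fun q : Pt2 => ((q.1, q.2, w) : Pt3)) '' S =
          (fun p : Pt3 => (p.1, p.2.1)) ⁻¹' S ∩ {p | p.2.2 = w} := by
        ext ⟨x, y, z⟩
        constructor
        · rintro ⟨⟨x', y'⟩, h, h'⟩
          simp only [Prod.mk.injEq] at h'
          obtain ⟨rfl, rfl, rfl⟩ := h'
          exact ⟨h, rfl⟩
        · rintro ⟨h, rfl⟩
          exact ⟨(x, y), h, rfl⟩
      rw [this]
      exact (hS.preimage (by fun_prop)).inter (isClosed_eq (by fun_prop) continuous_const)
  have hloc : ∀ q ∈ slice T w, ∃ V ∈ 𝓝 q, (slice T w ∩ V).Finite := by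
    rintro ⟨x, y⟩ hq
    obtain ⟨U, γ, J, hU, hpU, hγ, -, -, hJ, -, -, hTU⟩ := hT.manifold (x, y, w) hq
    have hnhds : {p : Pt2 × ℝ | ((p.1.1, p.1.2, p.2) : Pt3) ∈ U} ∈ 𝓝 (((x, y), w) : Pt2 × ℝ) :=
      (hU.preimage (by fun_prop : Continuous fun p : Pt2 × ℝ =>
        ((p.1.1, p.1.2, p.2) : Pt3))).mem_nhds hpU
    obtain ⟨V, hV, W, hW, hVW⟩ := mem_nhds_prod_iff.1 hnhds
    obtain ⟨r', s', hw', hsub⟩ :=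
      mem_nhds_iff_exists_Ioo_subset.1 (Filter.inter_mem hW (Ioo_mem_nhds hw.1 hw.2))
    refine ⟨V, hV, finite_of_vertical_subset_curve hγ (J := J) ?_ ?_ (hw'.1.trans hw'.2) ?_⟩
    · rcases hJ with rfl | rfl
      · exact measurableSet_Ioo
      · exact measurableSet_Ico
    · rcases hJ with rfl | rfl
      · exact Ioo_subset_Icc_self
      · exact fun t ht => ⟨by linarith [ht.1], ht.2.le⟩
    · rintro ⟨x', y'⟩ ⟨hq', hqV⟩ z hz
      rw [← hTU]
      refine ⟨?_, hVW (mk_mem_prod hqV (hsub hz).1)⟩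
      exact (hprod x' y' w (Ioo_subset_Icc_self hw) z (Ioo_subset_Icc_self (hsub hz).2)).1 hq'
  choose! V hV hfin using hloc
  obtain ⟨t, ht, htcov⟩ := hcomp.elim_nhds_subcover V hV
  refine (t.finite_toSet.biUnion fun q hq => hfin q (ht q hq)).subset fun q hq => ?_
  obtain ⟨q', hq', hmem⟩ := mem_iUnion₂.1 (htcov hq)
  exact mem_iUnion₂.2 ⟨q', hq', hq, hmem⟩

/-- Where a generic tangle is a product, points of its slices are determined by their `y`
coordinates. -/
theorem injOn_snd_slice {T : Set Pt3} (hT : IsGenericTangle T) {r s w : ℝ} (hw : w ∈ Ioo r s)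
    (hprod : ProductZOn T r s) : InjOn Prod.snd (slice T w) := by
  rintro ⟨x, y⟩ hq ⟨x', y'⟩ hq' hyy'
  simp only at hyy'
  subst hyy'
  by_contra hne
  obtain ⟨-, Cr, Ex, -, hinj, -⟩ := hT
  refine (Ioo_infinite (hw.1.trans hw.2)) ((Cr.finite_toSet.preimage (f := fun z => (y, z))
    (by simp [InjOn])).subset fun z hz => ?_)
  by_contra hz'
  have hw' := Ioo_subset_Icc_self hw
  have hz'' := Ioo_subset_Icc_self hz
  have := hinj (x₁ := (x, y, z)) ⟨(hprod x y w hw' z hz'').1 hq, hz'⟩ (x₂ := (x', y, z))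
    ⟨(hprod x' y w hw' z hz'').1 hq', hz'⟩ rfl
  simp_all

/-- A reparametrization of the unit interval fixing `[0, 1/4]` and compressing `[3/8, 1]` into
`[μ, 1]`. -/
theorem exists_stretch {μ : ℝ} (h0 : 0 < μ) (h1 : μ < 1) : ∃ σ : ℝ → ℝ, ContDiff ℝ ∞ σ ∧
    (∀ z ∈ II, 0 < deriv σ z) ∧ MapsTo σ II II ∧ (∀ z ≤ 1/4, σ z = z) ∧ (∀ z ∈ II, z ≤ σ z) ∧
    ∀ z ∈ II, 3/8 ≤ z → μ ≤ σ z := by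
  let τ : ℝ → ℝ := fun z => Real.smoothTransition (8 * (z - 1/4))
  have hτ : ContDiff ℝ ∞ τ := Real.smoothTransition.contDiff.comp (by fun_prop)
  have hτ0 : ∀ z, 0 ≤ τ z := fun z => Real.smoothTransition.nonneg _
  have hτ1 : ∀ z, τ z ≤ 1 := fun z => Real.smoothTransition.le_one _
  have hmono : Monotone τ := fun u v huv => Real.smoothTransition.monotone (by linarith)
  have hle : ∀ z ∈ II, 0 ≤ μ * (1 - z) * τ z ∧ μ * (1 - z) * τ z ≤ 1 - z := fun z hz => by
    have h2 : 0 ≤ 1 - z := by linarith [hz.2]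
    have h3 : 0 ≤ μ * (1 - z) := by positivity
    refine ⟨mul_nonneg h3 (hτ0 z), ?_⟩
    nlinarith [hτ1 z]
  refine ⟨fun z => z + μ * (1 - z) * τ z, by fun_prop, fun z hz => ?_, fun z hz => ?_,
    fun z hz => ?_, fun z hz => ?_, fun z hz hz' => ?_⟩
  · have hd := (hτ.differentiable (by simp) z).hasDerivAt
    refine deriv_pos_of_hasDerivAt ((hasDerivAt_id z).add
      ((((hasDerivAt_id z).const_sub 1).const_mul μ).mul hd)) ?_
    have h2 : 0 ≤ μ * (1 - z) * deriv τ z :=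
      mul_nonneg (mul_nonneg h0.le (by linarith [hz.2])) hmono.deriv_nonneg
    simp only [id]
    nlinarith [hτ1 z, hτ0 z]
  · exact ⟨by linarith [(hle z hz).1, hz.1], by linarith [(hle z hz).2]⟩
  · have : τ z = 0 := Real.smoothTransition.zero_of_nonpos (by linarith)
    simp [this]
  · linarith [(hle z hz).1]
  · have : τ z = 1 := Real.smoothTransition.one_of_one_le (by linarith)
    simp only [this]
    nlinarith [hz.1]

theorem CarriesSlice.congr {a a' : Pt3 → ℝ} {b b' : Pt2 → ℝ} {c c' : ℝ → ℝ} {f f' T T' : Set Pt3}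
    {z w : ℝ} (h : CarriesSlice a b c f f' w) (hT : ∀ x y, (x, y, z) ∈ T ↔ (x, y, w) ∈ f)
    (hT' : ∀ x y, (x, y, c' z) ∈ T' ↔ (x, y, c w) ∈ f')
    (hab : ∀ x y, (x, y, w) ∈ f → a' (x, y, z) = a (x, y, w) ∧ b' (y, z) = b (y, w)) :
    CarriesSlice a' b' c' T T' z := by
  intro x' y'
  rw [hT', h]
  refine exists_congr fun x => exists_congr fun y => ?_
  rw [hT]
  refine and_congr_right fun hm => ?_
  rw [(hab x y hm).1, (hab x y hm).2]

theorem ProductZOn.mem_iff_of_stretch {T : Set Pt3} (hT : ProductZOn T (1/4) 1) {z w : ℝ}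
    (hw : w ∈ II) (hz : z ∈ II) (h : z = w ∨ 1/4 ≤ z ∧ 1/4 ≤ w) (x y : ℝ) :
    (x, y, z) ∈ T ↔ (x, y, w) ∈ T := by
  rcases h with rfl | ⟨h, h'⟩
  · rfl
  · exact hT x y z ⟨h, hz.2⟩ w ⟨h', hw.2⟩

/-- If tangles are products above height `1/4`, a triangular map between them can be replaced by one
whose image lies below height `1/2`. -/
theorem IsTri.exists_lower {a : Pt3 → ℝ} {b : Pt2 → ℝ} {c : ℝ → ℝ} {f f' : Set Pt3}
    (h : IsTri a b c) {ε : ℝ} (hε : 0 < ε) (hbot : ProductOn a b c (II ∩ Iic ε) 0)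
    (htop : ProductOn a b c (II ∩ Ici (1 - ε)) 1) (hcar : ∀ z ∈ II, CarriesSlice a b c f f' z)
    (hf : ProductZOn f (1/4) 1) (hf' : ProductZOn f' (1/4) 1) :
    ∃ a' b' c', IsTri a' b' c' ∧ (∃ ε > 0, ProductOn a' b' c' (II ∩ Iic ε) 0) ∧
      (∀ z ∈ II, CarriesSlice a' b' c' f f' z) ∧ (∀ z ∈ II, c' z < 1/2) ∧
      ∀ z ∈ II, 3/8 ≤ z → 1/4 ≤ c' z := by
  obtain ⟨κ, hκ, hκp, hκid, hκ1⟩ := exists_squeeze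
  have hμ0 : 0 < 1 - min ε (1/2) := by linarith [min_le_right ε (1/2)]
  have hμ1 : 1 - min ε (1/2) < 1 := by linarith [lt_min hε (one_half_pos (α := ℝ))]
  obtain ⟨σ, hσ, hσp, hσm, hσid, hσle, hσμ⟩ := exists_stretch hμ0 hμ1
  have hκmono : StrictMono κ := strictMono_of_deriv_pos hκp
  have hκlt : ∀ w ∈ II, κ w < 1/2 := fun w hw => (hκmono.monotone hw.2).trans_lt hκ1
  have hκ4 : ∀ w, 1/4 ≤ w → 1/4 ≤ κ w := fun w hw =>
    (hκid (1/4) le_rfl).symm.trans_le (hκmono.monotone hw)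
  have hκm : MapsTo κ II II := fun w hw =>
    ⟨by simpa [hκid 0 (by norm_num)] using hκmono.monotone hw.1, by linarith [hκlt w hw]⟩
  refine ⟨_, _, _, h.reparam hσ hκ hσm hκm hσp fun z _ => hκp z, ⟨min ε (1/4), by positivity, ?_⟩,
    fun z hz => ?_, fun z hz => hκlt _ (h.mem_c _ (hσm hz)), fun z hz hz' => hκ4 _ ?_⟩
  · rintro z ⟨hz, hz'⟩
    obtain ⟨hzε, hz4⟩ := le_min_iff.1 (mem_Iic.1 hz')
    obtain ⟨h1, h2, h3⟩ := hbot z ⟨hz, hzε⟩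
    simp only [hσid z hz4, hσid 0 (by norm_num), h3, hκid z hz4]
    exact ⟨h1, h2, trivial⟩
  · refine (hcar _ (hσm hz)).congr (hf.mem_iff_of_stretch (hσm hz) hz ?_)
      (hf'.mem_iff_of_stretch (h.mem_c _ (hσm hz)) (hκm (h.mem_c _ (hσm hz))) ?_)
      fun x y _ => ⟨rfl, rfl⟩
    · rcases le_total z (1/4) with h4 | h4
      · exact Or.inl (hσid z h4).symm
      · exact Or.inr ⟨h4, h4.trans (hσle z hz)⟩
    · rcases le_total (c (σ z)) (1/4) with h4 | h4
      · exact Or.inl (hκid _ h4)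
      · exact Or.inr ⟨hκ4 _ h4, h4⟩
  · have hge := hσμ z hz hz'
    rw [(htop (σ z) ⟨hσm hz, mem_Ici.2 (by linarith [min_le_left ε (1/2)])⟩).2.2]
    linarith [min_le_right ε (1/2)]

theorem one_sub_mem_II {z : ℝ} (hz : z ∈ II) : 1 - z ∈ II :=
  ⟨by linarith [hz.2], by linarith [hz.1]⟩

theorem IsTri.reflect {a : Pt3 → ℝ} {b : Pt2 → ℝ} {c : ℝ → ℝ} (h : IsTri a b c) :
    IsTri (fun p => a (p.1, p.2.1, 1 - p.2.2)) (fun q => b (q.1, 1 - q.2))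
      (fun z => 1 - c (1 - z)) := by
  have := h.smooth_a
  have := h.smooth_b
  have := h.smooth_c
  refine ⟨by fun_prop, by fun_prop, by fun_prop, ?_, ?_, ?_, ?_, ?_, ?_⟩
  · exact fun x hx y hy z hz => h.mem_a x hx y hy _ (one_sub_mem_II hz)
  · exact fun y hy z hz => h.mem_b y hy _ (one_sub_mem_II hz)
  · exact fun z hz => one_sub_mem_II (h.mem_c _ (one_sub_mem_II hz))
  · exact fun x hx y hy z hz => h.pos_a x hx y hy _ (one_sub_mem_II hz)
  · exact fun y hy z hz => h.pos_b y hy _ (one_sub_mem_II hz)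
  · intro z hz
    have h2 := ((h.diff_c (1 - z)).hasDerivAt.comp z ((hasDerivAt_id z).const_sub 1)).const_sub 1
    exact deriv_pos_of_hasDerivAt h2 (by simpa using h.pos_c _ (one_sub_mem_II hz))

theorem CarriesSlice.reflect {a : Pt3 → ℝ} {b : Pt2 → ℝ} {c : ℝ → ℝ} {f f' : Set Pt3} {z : ℝ}
    (h : CarriesSlice a b c f f' (1 - z)) :
    CarriesSlice (fun p => a (p.1, p.2.1, 1 - p.2.2)) (fun q => b (q.1, 1 - q.2))
      (fun z => 1 - c (1 - z)) (reflZ3 f) (reflZ3 f') z :=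
  h.congr (fun _ _ => Iff.rfl) (fun x y => by simp [reflZ3]) fun _ _ _ => ⟨rfl, rfl⟩

theorem ProductOn.reflect {a : Pt3 → ℝ} {b : Pt2 → ℝ} {c : ℝ → ℝ} {S S' : Set ℝ} {z₀ z₁ : ℝ}
    (h : ProductOn a b c S z₀) (hz₁ : 1 - z₁ = z₀) (hS : ∀ z ∈ S', 1 - z ∈ S) :
    ProductOn (fun p => a (p.1, p.2.1, 1 - p.2.2)) (fun q => b (q.1, 1 - q.2))
      (fun z => 1 - c (1 - z)) S' z₁ := by
  subst hz₁
  intro z hz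
  obtain ⟨h1, h2, h3⟩ := h _ (hS z hz)
  exact ⟨h1, h2, by simp [h3]⟩

theorem reflZ3_reflZ3 (T : Set Pt3) : reflZ3 (reflZ3 T) = T := by
  ext; simp [reflZ3]

theorem ProductZOn.reflect {T : Set Pt3} (h : ProductZOn T 0 (3/4)) :
    ProductZOn (reflZ3 T) (1/4) 1 := fun x y z hz z' hz' =>
  h x y (1 - z) ⟨by linarith [hz.2], by linarith [hz.1]⟩ (1 - z')
    ⟨by linarith [hz'.2], by linarith [hz'.1]⟩

/-- If tangles are products below height `3/4`, a triangular map between them can be replaced by one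
whose image lies above height `1/2`. -/
theorem IsTri.exists_upper {a : Pt3 → ℝ} {b : Pt2 → ℝ} {c : ℝ → ℝ} {g g' : Set Pt3}
    (h : IsTri a b c) {ε : ℝ} (hε : 0 < ε) (hbot : ProductOn a b c (II ∩ Iic ε) 0)
    (htop : ProductOn a b c (II ∩ Ici (1 - ε)) 1) (hcar : ∀ z ∈ II, CarriesSlice a b c g g' z)
    (hg : ProductZOn g 0 (3/4)) (hg' : ProductZOn g' 0 (3/4)) :
    ∃ a' b' c', IsTri a' b' c' ∧ (∃ ε > 0, ProductOn a' b' c' (II ∩ Ici (1 - ε)) 1) ∧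
      (∀ z ∈ II, CarriesSlice a' b' c' g g' z) ∧ (∀ z ∈ II, 1/2 < c' z) ∧
      ∀ z ∈ II, z ≤ 5/8 → c' z ≤ 3/4 := by
  obtain ⟨a', b', c', h', ⟨ε', hε', hbot'⟩, hcar', hlt, hge⟩ := h.reflect.exists_lower
    (f := reflZ3 g) (f' := reflZ3 g') hε
    (htop.reflect (by norm_num) fun z hz =>
      ⟨one_sub_mem_II hz.1, mem_Ici.2 (by linarith [mem_Iic.1 hz.2])⟩)
    (hbot.reflect (by norm_num) fun z hz =>
      ⟨one_sub_mem_II hz.1, mem_Iic.2 (by linarith [mem_Ici.1 hz.2])⟩)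
    (fun z hz => (hcar _ (one_sub_mem_II hz)).reflect) hg.reflect hg'.reflect
  refine ⟨_, _, _, h'.reflect, ⟨ε', hε', hbot'.reflect (by norm_num) fun z hz =>
      ⟨one_sub_mem_II hz.1, mem_Iic.2 (by linarith [mem_Ici.1 hz.2])⟩⟩, fun z hz => ?_,
      fun z hz => ?_, fun z hz hz' => ?_⟩
  · simpa only [reflZ3_reflZ3] using (hcar' _ (one_sub_mem_II hz)).reflect
  · linarith [hlt _ (one_sub_mem_II hz)]
  · linarith [hge _ (one_sub_mem_II hz) (by linarith)]

/-- Two maps of the square that are strictly increasing in `y` and have the same image on a finite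
set agree there, provided the points of the image are determined by their `y` coordinates. -/
theorem eq_of_image_eq {A A' : Set Pt2} (hA : A.Finite) (hA2 : ∀ q ∈ A, q.2 ∈ II)
    (hinj : InjOn Prod.snd A') {α α' : ℝ → ℝ → ℝ} {β β' : ℝ → ℝ} (hβ : StrictMonoOn β II)
    (hβ' : StrictMonoOn β' II)
    (h : ∀ x' y', (x', y') ∈ A' ↔ ∃ x y, (x, y) ∈ A ∧ α x y = x' ∧ β y = y')
    (h' : ∀ x' y', (x', y') ∈ A' ↔ ∃ x y, (x, y) ∈ A ∧ α' x y = x' ∧ β' y = y')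
    {x y : ℝ} (hq : (x, y) ∈ A) : α x y = α' x y ∧ β y = β' y := by
  have hS : ∀ y : ↥(Prod.snd '' A), y.1 ∈ II := by
    rintro ⟨_, q, hq, rfl⟩
    exact hA2 q hq
  have : Finite ↥(Prod.snd '' A) := (hA.image _).to_subtype
  have hrange : ∀ {α : ℝ → ℝ → ℝ} {β : ℝ → ℝ},
      (∀ x' y', (x', y') ∈ A' ↔ ∃ x y, (x, y) ∈ A ∧ α x y = x' ∧ β y = y') →
      range (fun y : ↥(Prod.snd '' A) => β y) = Prod.snd '' A' := by
    intro α β h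
    ext v
    constructor
    · rintro ⟨⟨_, ⟨x, y⟩, hq, rfl⟩, rfl⟩
      exact ⟨(α x y, β y), (h _ _).2 ⟨x, y, hq, rfl, rfl⟩, rfl⟩
    · rintro ⟨⟨x', y'⟩, hq, rfl⟩
      obtain ⟨x, y, hm, -, hy⟩ := (h _ _).1 hq
      exact ⟨⟨y, (x, y), hm, rfl⟩, hy⟩
  have hfun := (StrictMono.range_inj (fun u v huv => hβ (hS u) (hS v) huv)
    (fun u v huv => hβ' (hS u) (hS v) huv)).1 ((hrange h).trans (hrange h').symm)
  have hy : β y = β' y := congrFun hfun ⟨y, (x, y), hq, rfl⟩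
  refine ⟨?_, hy⟩
  have := hinj ((h _ _).2 ⟨x, y, hq, rfl, rfl⟩) ((h' _ _).2 ⟨x, y, hq, rfl, rfl⟩) hy
  exact congrArg Prod.fst this

theorem mem_glueZ_iff_left {f g : Set Pt3} (hmatch : tgtSet f = srcSet g)
    (hf : ProductZOn f (1/4) 1) (hg : ProductZOn g 0 (3/4)) {z : ℝ} (hz : z ≤ 3/4) (x y : ℝ) :
    (x, y, z) ∈ glueZ f g ↔ (x, y, z) ∈ f := by
  rcases lt_or_ge z (1/2) with h | h
  · simp [glueZ, z3, -one_div, h.le, h.not_ge]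
  · have h1 := hf x y z ⟨by linarith, by linarith⟩ 1 ⟨by norm_num, le_rfl⟩
    have h2 := hg x y 0 ⟨le_rfl, by norm_num⟩ z ⟨by linarith, hz⟩
    have h3 : (x, y, (1:ℝ)) ∈ f ↔ (x, y, (0:ℝ)) ∈ g := Set.ext_iff.1 hmatch (x, y)
    simp only [glueZ, z3, mem_union, mem_ofPred_eq]
    tauto

theorem mem_glueZ_iff_right {f g : Set Pt3} (hmatch : tgtSet f = srcSet g)
    (hf : ProductZOn f (1/4) 1) (hg : ProductZOn g 0 (3/4)) {z : ℝ} (hz : 1/4 ≤ z) (x y : ℝ) :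
    (x, y, z) ∈ glueZ f g ↔ (x, y, z) ∈ g := by
  rcases lt_or_ge (1/2) z with h | h
  · simp [glueZ, z3, -one_div, h.le, h.not_ge]
  · have h1 := hf x y z ⟨hz, by linarith⟩ 1 ⟨by norm_num, le_rfl⟩
    have h2 := hg x y 0 ⟨le_rfl, by norm_num⟩ z ⟨by linarith, by linarith⟩
    have h3 : (x, y, (1:ℝ)) ∈ f ↔ (x, y, (0:ℝ)) ∈ g := Set.ext_iff.1 hmatch (x, y)
    simp only [glueZ, z3, mem_union, mem_ofPred_eq]
    tauto

/-- A tangle stays away from the faces of the cube parallel to the `z` axis. -/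
theorem exists_margin {T : Set Pt3} (hT : IsTangle T) : ∃ δ > 0, ∀ x y z, (x, y, z) ∈ T →
    x ∈ Icc δ (1 - δ) ∧ y ∈ Icc δ (1 - δ) := by
  obtain ⟨δ, hδ, h⟩ := hT.compact.exists_forall_le' (f := fun p : Pt3 =>
    min (min p.1 (1 - p.1)) (min p.2.1 (1 - p.2.1))) (by fun_prop) (a := 0) fun p hp => by
      obtain ⟨⟨h1, h2⟩, ⟨h3, h4⟩, -⟩ := hT.subset hp
      exact lt_min (lt_min h1 (sub_pos.2 h2)) (lt_min h3 (sub_pos.2 h4))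
  refine ⟨δ, hδ, fun x y z hp => ?_⟩
  have := h _ hp
  simp only [le_min_iff] at this
  obtain ⟨⟨h1, h2⟩, h3, h4⟩ := this
  exact ⟨⟨h1, by linarith⟩, h3, by linarith⟩

/-- **Composition of 1-morphisms in the 2-category `𝒯` of 2-tangles is well
defined** (part of Lemma 1 of HDA IV): if `f, f'` are equivalent generic
tangles and `g, g'` are equivalent generic tangles, chosen so that the target
set of (each representative of) `f` equals the source set of (the corresponding
representative of) `g`, the representatives of `f` have a product structure in
the `z` direction for `z ∈ [1/4,1]` and those of `g` for `z ∈ [0,3/4]`, then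
the glued tangles `(f ∩ I₁×I₂×[0,1/2]) ∪ (g ∩ I₁×I₂×[1/2,1])` and
`(f' ∩ I₁×I₂×[0,1/2]) ∪ (g' ∩ I₁×I₂×[1/2,1])` are equivalent generic tangles;
hence the equivalence class of the glued tangle is independent of all choices
of representatives. -/
theorem composition_of_one_morphisms_well_defined
    (f g f' g' : Set Pt3)
    (hf : IsGenericTangle f) (hg : IsGenericTangle g)
    (hf' : IsGenericTangle f') (hg' : IsGenericTangle g')
    (hff' : TangleEquiv f f') (hgg' : TangleEquiv g g')
    (hmatch : tgtSet f = srcSet g) (hmatch' : tgtSet f' = srcSet g')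
    (hfp : ProductZOn f (1/4) 1) (hgp : ProductZOn g 0 (3/4))
    (hfp' : ProductZOn f' (1/4) 1) (hgp' : ProductZOn g' 0 (3/4)) :
    TangleEquiv (glueZ f g) (glueZ f' g') := by
  obtain ⟨a₁, b₁, c₁, h₁, ⟨ε₁, hε₁, hbot₁, htop₁⟩, hcar₁⟩ :=
    exists_isTri_of_tangleEquiv (fun p hp => (hf.1.subset hp).2.2) hff'
  obtain ⟨a₂, b₂, c₂, h₂, ⟨ε₂, hε₂, hbot₂, htop₂⟩, hcar₂⟩ :=
    exists_isTri_of_tangleEquiv (fun p hp => (hg.1.subset hp).2.2) hgg'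
  obtain ⟨a, b, c, h, ⟨ε, hε, hbot⟩, hcar, hlt, hge⟩ :=
    h₁.exists_lower hε₁ hbot₁ htop₁ hcar₁ hfp hfp'
  obtain ⟨a', b', c', h', ⟨ε', hε', htop⟩, hcar', hgt, hle⟩ :=
    h₂.exists_upper hε₂ hbot₂ htop₂ hcar₂ hgp hgp'
  let l : ℝ → ℝ := fun z => Real.smoothTransition (4 * (z - 3/8))
  have hl : ContDiff ℝ ∞ l := Real.smoothTransition.contDiff.comp (by fun_prop)
  have hlm : Monotone l := fun u v huv => Real.smoothTransition.monotone (by linarith)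
  have hl0 : ∀ z ≤ 3/8, l z = 0 := fun z hz =>
    Real.smoothTransition.zero_of_nonpos (by linarith)
  have hl1 : ∀ z, 5/8 ≤ z → l z = 1 := fun z hz =>
    Real.smoothTransition.one_of_one_le (by linarith)
  have hlnn : ∀ z, 0 ≤ l z := fun z => Real.smoothTransition.nonneg _
  have hlle : ∀ z, l z ≤ 1 := fun z => Real.smoothTransition.le_one _
  have hmix := h.mix h' hl hlnn hlle fun z hz =>
    mul_nonneg hlm.deriv_nonneg (by linarith [hlt z hz, hgt z hz])
  obtain ⟨δ₁, hδ₁, hmar₁⟩ := exists_margin hf.1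
  obtain ⟨δ₂, hδ₂, hmar₂⟩ := exists_margin hg.1
  let δ := min (min δ₁ δ₂) (1/4)
  have hδ : 0 < δ := by positivity
  have hδ₁' : δ ≤ δ₁ := (min_le_left _ _).trans (min_le_left _ _)
  have hδ₂' : δ ≤ δ₂ := (min_le_left _ _).trans (min_le_right _ _)
  have hc0 : c 0 = 0 := (hbot 0 ⟨zero_mem_II, hε.le⟩).2.2
  have hc1 : c' 1 = 1 := (htop 1 ⟨one_mem_II, by simpa using hε'.le⟩).2.2
  have hl00 := hl0 0 (by norm_num)
  have hl11 := hl1 1 (by norm_num)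
  obtain ⟨φ, hφ, hcap, hfaces⟩ := hmix.exists_fixesFaces (by simp [hl00, hc0])
    (by simp [hl11, hc1]) hδ ((min_le_right _ _).trans_lt (by norm_num))
  have hφf : ∀ {x y z}, (x, y, z) ∈ f → (∀ v, φ x v = v) ∧ ∀ v, φ y v = v := fun hp =>
    ⟨hφ _ ⟨hδ₁'.trans (hmar₁ _ _ _ hp).1.1, by linarith [(hmar₁ _ _ _ hp).1.2]⟩,
      hφ _ ⟨hδ₁'.trans (hmar₁ _ _ _ hp).2.1, by linarith [(hmar₁ _ _ _ hp).2.2]⟩⟩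
  have hφg : ∀ {x y z}, (x, y, z) ∈ g → (∀ v, φ x v = v) ∧ ∀ v, φ y v = v := fun hp =>
    ⟨hφ _ ⟨hδ₂'.trans (hmar₂ _ _ _ hp).1.1, by linarith [(hmar₂ _ _ _ hp).1.2]⟩,
      hφ _ ⟨hδ₂'.trans (hmar₂ _ _ _ hp).2.1, by linarith [(hmar₂ _ _ _ hp).2.2]⟩⟩
  refine tangleEquiv_of_isTri hcap hfaces (ε := min (min ε ε') (3/8)) (by positivity) ?_ ?_ ?_ ?_ ?_
  · rintro z ⟨hz, hz'⟩
    simp only [mem_Iic, le_min_iff] at hz'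
    obtain ⟨p1, p2, p3⟩ := hbot z ⟨hz, hz'.1.1⟩
    simp only [hl0 z hz'.2, hl00, p1, p2, p3]
    simp
  · rintro z ⟨hz, hz'⟩
    have hmin := mem_Ici.1 hz'
    have e1 : min (min ε ε') (3/8) ≤ ε' := (min_le_left _ _).trans (min_le_right _ _)
    have e2 : min (min ε ε') (3/8) ≤ 3/8 := min_le_right _ _
    obtain ⟨p1, p2, p3⟩ := htop z ⟨hz, mem_Ici.2 (by linarith)⟩
    simp only [hl1 z (by linarith), hl11, p1, p2, p3]
    simp
  · rintro p (⟨hp, -⟩ | ⟨hp, -⟩)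
    exacts [(hf.1.subset hp).2.2, (hg.1.subset hp).2.2]
  · rintro p (⟨hp, -⟩ | ⟨hp, -⟩)
    exacts [(hf'.1.subset hp).2.2, (hg'.1.subset hp).2.2]
  · intro z hz
    have hleft := fun {z} => mem_glueZ_iff_left hmatch hfp hgp (z := z)
    have hright := fun {z} => mem_glueZ_iff_right hmatch hfp hgp (z := z)
    have hleft' := fun {z} => mem_glueZ_iff_left hmatch' hfp' hgp' (z := z)
    have hright' := fun {z} => mem_glueZ_iff_right hmatch' hfp' hgp' (z := z)
    rcases le_total z (3/8) with hz3 | hz3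
    · refine (hcar z hz).congr (hleft (by linarith)) ?_ fun x y hp => ?_
      · simpa [hl0 z hz3] using hleft' (by linarith [hlt z hz])
      · simp [hl0 z hz3, (hφf hp).1, (hφf hp).2]
    rcases le_total (5/8) z with hz5 | hz5
    · refine (hcar' z hz).congr (hright (by linarith)) ?_ fun x y hp => ?_
      · simpa [hl1 z hz5] using hright' (by linarith [hgt z hz])
      · simp [hl1 z hz5, (hφg hp).1, (hφg hp).2]
    have hz_mem : z ∈ Ioo (1/4 : ℝ) 1 := ⟨by linarith, by linarith⟩
    have hhalf : (1/2 : ℝ) ∈ Ioo (1/4 : ℝ) 1 := by norm_num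
    have hlow := hge z hz hz3
    have hlow' := hlt z hz
    have hupp := hle z hz hz5
    have hupp' := hgt z hz
    have hagree : ∀ {x y}, (x, y, z) ∈ f → a (x, y, z) = a' (x, y, z) ∧ b (y, z) = b' (y, z) := by
      intro x y hp
      refine eq_of_image_eq (A' := slice f' (1/2)) (α := fun x y => a (x, y, z))
        (α' := fun x y => a' (x, y, z)) (β := fun y => b (y, z)) (β' := fun y => b' (y, z))
        (finite_slice hf.1 hz_mem hfp)
        (fun q hq => Ioo_subset_Icc_self (hf.1.subset hq).2.1) (injOn_snd_slice hf' hhalf hfp')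
        (h.strictMonoOn_b hz) (h'.strictMonoOn_b hz) (fun x' y' => ?_) (fun x' y' => ?_) hp
      · exact (hfp' x' y' _ (Ioo_subset_Icc_self hhalf) (c z) ⟨hlow, by linarith⟩).trans
          (hcar z hz x' y')
      · refine (hfp' x' y' _ (Ioo_subset_Icc_self hhalf) (c' z)
          ⟨by linarith, by linarith⟩).trans ?_
        rw [← hleft' hupp, hright' (by linarith), hcar' z hz x' y']
        simp only [← hright (z := z) (by linarith), hleft (z := z) (by linarith)]
        rfl
    refine (hcar z hz).congr (hleft (by linarith)) (fun x y => ?_) fun x y hp => ?_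
    · have hC : (1 - l z) * c z + l z * c' z ∈ Icc (1/4) (3/4) := by
        constructor <;> nlinarith [hlnn z, hlle z]
      rw [hleft' hC.2]
      exact hfp' x y _ ⟨hC.1, by linarith [hC.2]⟩ _ ⟨hlow, by linarith⟩
    · simp only [(hφf hp).1, (hφf hp).2, ← (hagree hp).1, ← (hagree hp).2]
      constructor <;> ring

end HDA4
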